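/- arXiv:1608.04496 — 5 statements merged into one kernel-verified Lean document; each statement's English description precedes it below -/
import Mathlib

section
/- Let A be a finite set and Γ a nonempty set. For every natural number r with r < |A|, the r-th homology group of the chain complex C_*(A) vanishes: H_r(C_*(A)) = 0. -/
/-!
Formalization of: for a finite set `A` and a nonempty set `Γ`, the chain complex
`C_*(A)` (free abelian group on tuples `(a_1, …, a_r, γ_1, …, γ_r)` with the
`a_i` pairwise distinct elements of `A` and the `γ_i` arbitrary elements of `Γ`,
with differential the alternating sum of deletions) has vanishing homology in
every degree `r < |A|`.
-/

/-- A generator of `C_r(A)`: a tuple `(a_1, …, a_r, γ_1, …, γ_r)` where the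
`a_i` are pairwise distinct elements of `A` and the `γ_i` are elements of `Γ`. -/
structure IWGen (A Γ : Type) (r : ℕ) where
  letters : Fin r → A
  inj : Function.Injective letters
  colors : Fin r → Γ

/-- The degree-`r` part `C_r(A)`: the free abelian group on the generators. -/
abbrev IWChains (A Γ : Type) (r : ℕ) : Type := IWGen A Γ r →₀ ℤ

/-- The `i`-th face of a generator: delete the entries `a_i` and `γ_i`. -/
def IWface {A Γ : Type} {r : ℕ} (i : Fin (r + 1)) (g : IWGen A Γ (r + 1)) :
    IWGen A Γ r where
  letters := g.letters ∘ i.succAbove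
  inj := g.inj.comp Fin.succAbove_right_injective
  colors := g.colors ∘ i.succAbove

/-- The differential `d : C_{r+1}(A) → C_r(A)`,
`d(a_1, …, a_{r+1}, γ_1, …, γ_{r+1}) = Σ_{i=1}^{r+1} (-1)^{i-1}
(a_1, …, â_i, …, a_{r+1}, γ_1, …, γ̂_i, …, γ_{r+1})`. -/
noncomputable def IWd (A Γ : Type) (r : ℕ) : IWChains A Γ (r + 1) →+ IWChains A Γ r :=
  Finsupp.liftAddHom fun g =>
    zmultiplesHom _ (∑ i : Fin (r + 1), (-1 : ℤ) ^ (i : ℕ) • Finsupp.single (IWface i g) 1)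

/-- The `r`-cycles: all of `C_0(A)` in degree `0`, and `ker d` in positive degrees. -/
noncomputable def IWcycles (A Γ : Type) : (r : ℕ) → AddSubgroup (IWChains A Γ r)
  | 0 => ⊤
  | r + 1 => (IWd A Γ r).ker

/-- The `r`-boundaries: the image of `d : C_{r+1}(A) → C_r(A)`. -/
noncomputable def IWboundaries (A Γ : Type) (r : ℕ) : AddSubgroup (IWChains A Γ r) :=
  (IWd A Γ r).range

/-- The `r`-th homology group `H_r(C_*(A))`, as cycles modulo boundaries. -/
noncomputable def IWhomology (A Γ : Type) (r : ℕ) : Type :=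
  IWcycles A Γ r ⧸ (IWboundaries A Γ r).addSubgroupOf (IWcycles A Γ r)

namespace InjectiveWords

open Finsupp

variable {X A Γ : Type}

/-- The alternating sum of the one-letter deletions of a word. -/
noncomputable def wordBoundary : List X → (List X →₀ ℤ)
  | [] => 0
  | x :: w => single w 1 - mapDomain (List.cons x) (wordBoundary w)

/-- The linear extension of `wordBoundary` to the free abelian group on all words. -/
noncomputable def boundary : (List X →₀ ℤ) →ₗ[ℤ] (List X →₀ ℤ) :=
  linearCombination ℤ wordBoundary

/-- The coefficients of a chain at the words with prefix `t`, with `t` removed. -/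
noncomputable def stripPrefix (t : List X) : (List X →₀ ℤ) →ₗ[ℤ] (List X →₀ ℤ) :=
  lcomapDomain (t ++ ·) (List.append_right_injective t)

@[simp] lemma stripPrefix_apply (t : List X) (z : List X →₀ ℤ) (v : List X) :
    stripPrefix t z v = z (t ++ v) := rfl

@[simp] lemma boundary_single (w : List X) : boundary (single w 1) = wordBoundary w := by
  simp [boundary]

lemma boundary_mapDomain_cons (x : X) (z : List X →₀ ℤ) :
    boundary (mapDomain (List.cons x) z) = z - mapDomain (List.cons x) (boundary z) := by
  induction z using Finsupp.induction_linear with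
  | zero => simp
  | add f g hf hg => simp only [mapDomain_add, map_add, hf, hg]; abel
  | single w n =>
    simp [boundary, mapDomain_single, wordBoundary, smul_sub, mapDomain_smul]

lemma boundary_boundary (z : List X →₀ ℤ) : boundary (boundary z) = 0 := by
  have h (w : List X) : boundary (wordBoundary w) = 0 := by
    induction w with
    | nil => simp [wordBoundary]
    | cons x w ih => simp [wordBoundary, boundary_mapDomain_cons, ih]
  induction z using Finsupp.induction_linear with
  | zero => simp
  | add f g hf hg => simp only [map_add, hf, hg, add_zero]
  | single w n =>
    rw [← mul_one n, ← smul_eq_mul, ← smul_single, map_smul, map_smul, boundary_single, h,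
      smul_zero]

lemma wordBoundary_mem_supported (w : List X) :
    wordBoundary w ∈ supported ℤ ℤ {w' | w'.Sublist w ∧ w'.length + 1 = w.length} := by
  classical
  induction w with
  | nil => simp [wordBoundary]
  | cons x w ih =>
    refine Submodule.sub_mem _ (single_mem_supported _ _ ⟨List.sublist_cons_self x w, rfl⟩) ?_
    rw [mem_supported] at ih ⊢
    intro v hv
    obtain ⟨u, hu, rfl⟩ := Finset.mem_image.1 (mapDomain_support hv)
    obtain ⟨h₁, h₂⟩ := ih hu
    exact ⟨h₁.cons_cons x, by simp [h₂]⟩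

lemma boundary_mem_supported {P Q : Set (List X)}
    (h : ∀ w ∈ P, ∀ w', w'.Sublist w → w'.length + 1 = w.length → w' ∈ Q)
    {z : List X →₀ ℤ} (hz : z ∈ supported ℤ ℤ P) : boundary z ∈ supported ℤ ℤ Q := by
  rw [boundary, linearCombination_apply]
  refine Submodule.sum_mem _ fun w hw => Submodule.smul_mem _ _ ?_
  exact supported_mono (fun w' hw' => h w (hz hw) w' hw'.1 hw'.2) (wordBoundary_mem_supported w)

/-- The words in which the letter `a` does not occur after the first `p` positions. -/
def occursBefore (a : A) (p : ℕ) : Set (List (A × Γ)) := {w | ∀ x ∈ w.drop p, x.1 ≠ a}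

/-- The words of length `r` with pairwise distinct letters in `S`. -/
def injWords (S : Finset A) (r : ℕ) : Set (List (A × Γ)) :=
  {w | (w.map Prod.fst).Nodup ∧ (∀ x ∈ w, x.1 ∈ S) ∧ w.length = r}

lemma append_notMem_occursBefore {a : A} (u v : List (A × Γ)) {c : A × Γ} (hc : c.1 = a) :
    u ++ [c] ++ v ∉ occursBefore a u.length := by
  intro h
  exact h c (by simp) hc

lemma exists_eq_append_of_notMem_occursBefore {a : A} {p : ℕ} {w : List (A × Γ)}
    (h : w ∈ occursBefore a (p + 1)) (h' : w ∉ occursBefore a p) :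
    ∃ u c v, u.length = p ∧ c.1 = a ∧ w = u ++ [c] ++ v := by
  have hp : p < w.length := by
    by_contra hp
    exact h' (by simp [occursBefore, List.drop_eq_nil_of_le (not_lt.1 hp)])
  refine ⟨w.take p, w[p], w.drop (p + 1), by simp [hp.le], ?_, by simp⟩
  by_contra hne
  refine h' fun x hx => ?_
  rw [List.drop_eq_getElem_cons hp, List.mem_cons] at hx
  rcases hx with rfl | hx
  exacts [hne, h x hx]

lemma stripPrefix_wordBoundary {a : A} {c : A × Γ} (hc : c.1 = a) (u w : List (A × Γ))
    (hw : w ∈ occursBefore a (u.length + 1)) :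
    stripPrefix (u ++ [c]) (wordBoundary w) =
      (-1 : ℤ) ^ (u.length + 1) • boundary (stripPrefix (u ++ [c]) (single w 1)) := by
  classical
  have strip_cons_same (x : A × Γ) (t : List (A × Γ)) (z : List (A × Γ) →₀ ℤ) :
      stripPrefix (x :: t) (mapDomain (List.cons x) z) = stripPrefix t z := by
    ext v
    simp [mapDomain_apply (List.cons_injective (a := x))]
  have strip_cons_ne (x y : A × Γ) (hxy : x ≠ y) (t : List (A × Γ))
      (z : List (A × Γ) →₀ ℤ) : stripPrefix (x :: t) (mapDomain (List.cons y) z) = 0 := by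
    ext v
    rw [stripPrefix_apply, mapDomain_of_notMem_range _ _ (by simp [Ne.symm hxy])]
    rfl
  induction u generalizing w with
  | nil =>
    cases w with
    | nil =>
      have : stripPrefix [c] (single ([] : List (A × Γ)) (1 : ℤ)) = 0 := by
        ext v; simp
      simp [wordBoundary, this]
    | cons y w =>
      have hz : stripPrefix [c] (single w (1 : ℤ)) = 0 := by
        ext v
        rw [stripPrefix_apply, single_apply, if_neg]
        · rfl
        · rintro rfl
          exact hw c (by simp) hc
      have hs : single (y :: w) (1 : ℤ) = mapDomain (List.cons y) (single w 1) :=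
        mapDomain_single.symm
      by_cases h : c = y
      · subst h
        have h0 (z : List (A × Γ) →₀ ℤ) : stripPrefix [] z = z := by ext; simp
        simp [-mapDomain_single, wordBoundary, hz, hs, strip_cons_same, h0]
      · simp [-mapDomain_single, wordBoundary, hz, hs, strip_cons_ne _ _ h]
  | cons x u ih =>
    cases w with
    | nil =>
      have : stripPrefix (x :: (u ++ [c])) (single ([] : List (A × Γ)) (1 : ℤ)) = 0 := by
        ext v; simp
      simp [wordBoundary, this]
    | cons y w =>
      have hw' : w ∈ occursBefore a (u.length + 1) := by simpa [occursBefore] using hw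
      have hz : stripPrefix (x :: (u ++ [c])) (single w (1 : ℤ)) = 0 := by
        ext v
        rw [stripPrefix_apply, single_apply, if_neg]
        · rfl
        · rintro rfl
          exact append_notMem_occursBefore (x :: u) v hc (by simpa using hw')
      have hs : single (y :: w) (1 : ℤ) = mapDomain (List.cons y) (single w 1) :=
        mapDomain_single.symm
      by_cases h : x = y
      · subst h
        simp [-mapDomain_single, wordBoundary, hz, hs, strip_cons_same, ih w hw', pow_succ]
      · simp [-mapDomain_single, wordBoundary, hz, hs, strip_cons_ne _ _ h]

lemma stripPrefix_boundary {a : A} {c : A × Γ} (hc : c.1 = a) (u : List (A × Γ))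
    {z : List (A × Γ) →₀ ℤ} (hz : z ∈ supported ℤ ℤ (occursBefore a (u.length + 1))) :
    stripPrefix (u ++ [c]) (boundary z) =
      (-1 : ℤ) ^ (u.length + 1) • boundary (stripPrefix (u ++ [c]) z) := by
  rw [supported_eq_span_single] at hz
  induction hz using Submodule.span_induction with
  | mem _ h =>
    obtain ⟨w, hw, rfl⟩ := h
    simpa using stripPrefix_wordBoundary hc u w hw
  | zero => simp
  | add _ _ _ _ h₁ h₂ => simp only [map_add, h₁, h₂, smul_add]
  | smul n _ _ h => simp only [map_smul, h, smul_comm n]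

lemma boundary_mem_injWords {S : Finset A} {r : ℕ} {z : List (A × Γ) →₀ ℤ}
    (hz : z ∈ supported ℤ ℤ (injWords S (r + 1))) :
    boundary z ∈ supported ℤ ℤ (injWords S r) := by
  refine boundary_mem_supported (fun w hw w' hs hl => ?_) hz
  have := hw.2.2
  exact ⟨hw.1.sublist (hs.map _), fun x hx => hw.2.1 x (hs.subset hx), by omega⟩

lemma boundary_mem_occursBefore {a : A} {p : ℕ} {z : List (A × Γ) →₀ ℤ}
    (hz : z ∈ supported ℤ ℤ (occursBefore a p)) :
    boundary z ∈ supported ℤ ℤ (occursBefore a p) :=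
  by
  refine boundary_mem_supported (fun w hw w' hs _ => ?_) hz
  exact fun x hx => hw x ((hs.drop p).subset hx)

lemma append_mem_injWords_iff [DecidableEq A] {S : Finset A} {r : ℕ} {t v : List (A × Γ)} :
    t ++ v ∈ injWords S (t.length + r) ↔
      t ∈ injWords S t.length ∧ v ∈ injWords (S \ (t.map Prod.fst).toFinset) r := by
  simp only [injWords, Set.mem_ofPred_eq, List.map_append, List.nodup_append', List.mem_append,
    List.length_append, Finset.mem_sdiff, List.mem_toFinset, List.disjoint_right]
  simp only [List.mem_map]
  grind

/-- A cycle in which `a` occurs only in the first `p + 1` positions is homologous to one in which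
`a` occurs only in the first `p` positions, provided that shorter cycles in fewer letters are
boundaries. -/
lemma exists_sub_boundary_mem_occursBefore {S : Finset A} {r p : ℕ} (hr : r < S.card) (a : A)
    (ih : ∀ S' : Finset A, S'.card < S.card → ∀ r' < S'.card,
      ∀ z ∈ supported ℤ ℤ (injWords (Γ := Γ) S' r'), boundary z = 0 →
        ∃ y ∈ supported ℤ ℤ (injWords S' (r' + 1)), boundary y = z)
    {z : List (A × Γ) →₀ ℤ} (hz : z ∈ supported ℤ ℤ (injWords S r))
    (hza : z ∈ supported ℤ ℤ (occursBefore a (p + 1))) (hd : boundary z = 0) :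
    ∃ y ∈ supported ℤ ℤ (injWords S (r + 1)),
      z - boundary y ∈ supported ℤ ℤ (occursBefore a p) := by
  classical
  let T := (z.support.filter (· ∉ occursBefore a p)).image (List.take (p + 1))
  have hT : ∀ t ∈ T, t.length = p + 1 ∧ p + 1 ≤ r ∧ t ∈ injWords S t.length ∧
      ∃ u c, u.length = p ∧ c.1 = a ∧ t = u ++ [c] := by
    intro t ht
    obtain ⟨w, hw', rfl⟩ := Finset.mem_image.1 ht
    obtain ⟨hw, hwp⟩ := Finset.mem_filter.1 hw'
    clear ht hw'
    obtain ⟨u, c, v, rfl, hc, rfl⟩ := exists_eq_append_of_notMem_occursBefore (hza hw) hwp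
    have hl : r = (u ++ [c]).length + v.length := by rw [← (hz hw).2.2, List.length_append]
    have hm := hz hw
    rw [hl, append_mem_injWords_iff] at hm
    have ht' : (u ++ [c] ++ v).take (u.length + 1) = u ++ [c] := List.take_left' (by simp)
    rw [ht']
    exact ⟨by simp, by simp at hl; omega, hm.1, u, c, rfl, hc, rfl⟩
  have hfill : ∀ t ∈ T, ∃ y ∈ supported ℤ ℤ
      (injWords (S \ (t.map Prod.fst).toFinset) (r - (p + 1) + 1)),
      boundary y = stripPrefix t z := by
    intro t ht
    obtain ⟨hl, hpr, hts, u, c, hu, hc, rfl⟩ := hT t ht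
    have hcard : (S \ ((u ++ [c]).map Prod.fst).toFinset).card = S.card - (p + 1) := by
      rw [Finset.card_sdiff_of_subset, List.toFinset_card_of_nodup hts.1, List.length_map, hl]
      intro x hx
      obtain ⟨b, hb, rfl⟩ := List.mem_map.1 (List.mem_toFinset.1 hx)
      exact hts.2.1 b hb
    refine ih _ (by omega) _ (by omega) _ ?_ ?_
    · intro v hv
      have hm := hz (show (u ++ [c]) ++ v ∈ z.support by simpa using hv)
      rw [show r = (u ++ [c]).length + (r - (p + 1)) by omega, append_mem_injWords_iff] at hm
      exact hm.2
    · subst hu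
      have h := stripPrefix_boundary hc u hza
      rw [hd, map_zero] at h
      rcases neg_one_pow_eq_or ℤ (u.length + 1) with h1 | h1 <;> rw [h1] at h <;>
        simpa using h.symm
  choose! y hy hdy using hfill
  let m : List (A × Γ) →₀ ℤ := (-1 : ℤ) ^ (p + 1) • ∑ t ∈ T, mapDomain (t ++ ·) (y t)
  have hm : m ∈ supported ℤ ℤ (injWords S (r + 1) ∩ occursBefore a (p + 1)) := by
    refine Submodule.smul_mem _ _ (Submodule.sum_mem _ fun t ht => ?_)
    intro w hw
    obtain ⟨v, hv, rfl⟩ := Finset.mem_image.1 (mapDomain_support hw)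
    obtain ⟨hl, hpr, hts, u, c, hu, hc, htu⟩ := hT t ht
    have hv' := hy t ht hv
    refine ⟨?_, ?_⟩
    · rw [show r + 1 = t.length + (r - (p + 1) + 1) by omega]
      exact append_mem_injWords_iff.2 ⟨hts, hv'⟩
    · intro x hx
      simp only [← hl, List.drop_left] at hx
      have := hv'.2.1 x hx
      rintro rfl
      simp [htu, hc] at this
  have hmS := supported_mono Set.inter_subset_left hm
  have hma := supported_mono Set.inter_subset_right hm
  refine ⟨m, hmS, ?_⟩
  have hsub : z - boundary m ∈ supported ℤ ℤ (occursBefore a (p + 1)) :=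
    Submodule.sub_mem _ hza (boundary_mem_occursBefore hma)
  intro w hw
  by_contra hwp
  obtain ⟨u, c, v, rfl, hc, rfl⟩ := exists_eq_append_of_notMem_occursBefore (hsub hw) hwp
  have hstrip (t : List (A × Γ)) (ht : t ∈ T) :
      stripPrefix (u ++ [c]) (mapDomain (t ++ ·) (y t)) = if t = u ++ [c] then y t else 0 := by
    ext v
    rw [stripPrefix_apply]
    split_ifs with h
    · subst h
      exact mapDomain_apply (List.append_right_injective _) _ _
    · refine mapDomain_of_notMem_range _ _ ?_
      rintro ⟨v', hv'⟩
      exact h (List.append_inj_left hv' (by simp [(hT t ht).1]))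
  have hb : boundary (stripPrefix (u ++ [c]) (∑ t ∈ T, mapDomain (t ++ ·) (y t))) =
      stripPrefix (u ++ [c]) z := by
    rw [map_sum, Finset.sum_congr rfl hstrip, Finset.sum_ite_eq']
    split_ifs with h
    · exact hdy _ h
    · rw [map_zero]
      ext v
      by_contra hne
      refine h (Finset.mem_image.2 ⟨u ++ [c] ++ v, Finset.mem_filter.2
        ⟨mem_support_iff.2 fun h0 => hne ?_, append_notMem_occursBefore u v hc⟩,
          List.take_left' (by simp)⟩)
      exact h0.symm
  have h0 : stripPrefix (u ++ [c]) (z - boundary m) = 0 := by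
    rw [map_sub, stripPrefix_boundary hc u hma, map_smul, map_smul, smul_smul, ← mul_pow, hb]
    simp
  exact mem_support_iff.1 hw (DFunLike.congr_fun h0 v)

theorem exists_boundary_eq [Nonempty Γ] (S : Finset A) (r : ℕ) (hr : r < S.card)
    (z : List (A × Γ) →₀ ℤ) (hz : z ∈ supported ℤ ℤ (injWords S r)) (hd : boundary z = 0) :
    ∃ y ∈ supported ℤ ℤ (injWords S (r + 1)), boundary y = z := by
  classical
  induction hn : S.card using Nat.strong_induction_on generalizing S r z with
  | _ n ih =>
  subst hn
  obtain ⟨a, ha⟩ := Finset.card_pos.1 (by omega : 0 < S.card)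
  have key (p : ℕ) : ∀ z ∈ supported ℤ ℤ (injWords (Γ := Γ) S r),
      z ∈ supported ℤ ℤ (occursBefore a p) → boundary z = 0 →
      ∃ y ∈ supported ℤ ℤ (injWords S (r + 1)), boundary y = z := by
    induction p with
    | zero =>
      intro z hz hza hd
      obtain ⟨γ⟩ := ‹Nonempty Γ›
      refine ⟨mapDomain (List.cons (a, γ)) z, ?_, by simp [boundary_mapDomain_cons, hd]⟩
      intro w hw
      obtain ⟨v, hv, rfl⟩ := Finset.mem_image.1 (mapDomain_support hw)
      obtain ⟨h₁, h₂, h₃⟩ := hz hv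
      have h₄ := hza hv
      simp only [occursBefore, List.drop_zero, Set.mem_ofPred_eq] at h₄
      refine ⟨?_, ?_, by simp [h₃]⟩
      · rw [List.map_cons, List.nodup_cons]
        refine ⟨fun h => ?_, h₁⟩
        obtain ⟨x, hx, hxa⟩ := List.mem_map.1 h
        exact h₄ x hx hxa
      · intro x hx
        rcases List.mem_cons.1 hx with rfl | hx
        exacts [ha, h₂ x hx]
    | succ p ihp =>
      intro z hz hza hd
      obtain ⟨y, hy, hya⟩ := exists_sub_boundary_mem_occursBefore hr a
        (fun S' hS' r' hr' z hz hd => ih _ hS' S' r' hr' z hz hd rfl) hz hza hd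
      obtain ⟨y', hy', h⟩ := ihp _ (Submodule.sub_mem _ hz (boundary_mem_injWords hy)) hya
        (by rw [map_sub, hd, boundary_boundary, sub_zero])
      exact ⟨y' + y, Submodule.add_mem _ hy' hy, by rw [map_add, h, sub_add_cancel]⟩
  refine key r z hz (fun w hw => ?_) hd
  have := (hz hw).2.2
  simp [occursBefore, ← this]

/-- The word of letter-colour pairs underlying a generator. -/
def toWord {r : ℕ} (g : IWGen A Γ r) : List (A × Γ) :=
  List.ofFn fun i => (g.letters i, g.colors i)

lemma toWord_injective {r : ℕ} : Function.Injective (toWord (A := A) (Γ := Γ) (r := r)) := by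
  rintro ⟨l, hl, k⟩ ⟨l', hl', k'⟩ h
  have h := List.ofFn_injective h
  simp only [funext_iff, Prod.mk.injEq] at h
  obtain rfl : l = l' := funext fun i => (h i).1
  obtain rfl : k = k' := funext fun i => (h i).2
  rfl

lemma toWord_mem_injWords [Fintype A] {r : ℕ} (g : IWGen A Γ r) :
    toWord g ∈ injWords Finset.univ r := by
  refine ⟨?_, by simp, by simp [toWord]⟩
  simpa [toWord, List.map_ofFn, List.nodup_ofFn, Function.comp_def] using g.inj

lemma exists_toWord_eq [Fintype A] {r : ℕ} {w : List (A × Γ)}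
    (hw : w ∈ injWords Finset.univ r) : ∃ g : IWGen A Γ r, toWord g = w := by
  obtain ⟨h, -, rfl⟩ := hw
  refine ⟨⟨fun i => (w.get i).1, List.nodup_ofFn.1 ?_, fun i => (w.get i).2⟩, List.ofFn_get w⟩
  rwa [← List.ofFn_get w, List.map_ofFn] at h

lemma wordBoundary_ofFn {r : ℕ} (f : Fin (r + 1) → X) :
    wordBoundary (List.ofFn f) =
      ∑ i : Fin (r + 1), (-1 : ℤ) ^ (i : ℕ) • single (List.ofFn (f ∘ i.succAbove)) 1 := by
  induction r with
  | zero => simp [wordBoundary]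
  | succ r ih =>
    rw [List.ofFn_succ, wordBoundary, ih, Fin.sum_univ_succ (n := r + 1), sub_eq_add_neg,
      mapDomain_finsetSum, ← Finset.sum_neg_distrib]
    congr 1
    · simp [Function.comp_def]
    · refine Finset.sum_congr rfl fun i _ => ?_
      simp [mapDomain_single, pow_succ, List.ofFn_succ, Function.comp_def]

lemma mapDomain_toWord_IWd {r : ℕ} (z : IWChains A Γ (r + 1)) :
    mapDomain toWord (IWd A Γ r z) = boundary (mapDomain toWord z) := by
  induction z using Finsupp.induction_linear with
  | zero => simp
  | add f g hf hg => simp only [mapDomain_add, map_add, hf, hg]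
  | single g n =>
    have h : IWd A Γ r (single g n) = n • IWd A Γ r (single g 1) := by
      rw [← map_zsmul, smul_single, smul_eq_mul, mul_one]
    have h' : single g n = n • single g (1 : ℤ) := by simp
    rw [h, h', mapDomain_smul, mapDomain_smul, map_smul, mapDomain_single, boundary_single,
      toWord, wordBoundary_ofFn]
    simp only [IWd, liftAddHom_apply_single, zmultiplesHom_apply, one_smul, mapDomain_finsetSum,
      mapDomain_smul, mapDomain_single]
    rfl

lemma exists_mapDomain_toWord_eq [Fintype A] {r : ℕ} {y : List (A × Γ) →₀ ℤ}
    (hy : y ∈ supported ℤ ℤ (injWords Finset.univ r)) :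
    ∃ x : IWChains A Γ r, mapDomain toWord x = y := by
  refine ⟨comapDomain toWord y toWord_injective.injOn,
    mapDomain_comapDomain _ toWord_injective _ fun w hw => ?_⟩
  exact exists_toWord_eq (hy hw)

lemma boundary_mapDomain_toWord_eq_zero {r : ℕ} {z : IWChains A Γ r}
    (hz : z ∈ IWcycles A Γ r) : boundary (mapDomain toWord z) = 0 := by
  cases r with
  | zero =>
    clear hz
    induction z using Finsupp.induction_linear with
    | zero => simp
    | add f g hf hg => simp only [mapDomain_add, map_add, hf, hg, add_zero]
    | single g n => simp [toWord, boundary, wordBoundary, mapDomain_single]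
  | succ r =>
    have h : IWd A Γ r z = 0 := hz
    rw [← mapDomain_toWord_IWd, h, mapDomain_zero]

lemma cycles_le_boundaries [Fintype A] [Nonempty Γ] {r : ℕ} (hr : r < Fintype.card A) :
    IWcycles A Γ r ≤ IWboundaries A Γ r := by
  classical
  intro z hz
  have hzs : mapDomain toWord z ∈ supported ℤ ℤ (injWords (Γ := Γ) (Finset.univ : Finset A) r) := by
    intro w hw
    obtain ⟨g, -, rfl⟩ := Finset.mem_image.1 (mapDomain_support hw)
    exact toWord_mem_injWords g
  obtain ⟨y, hy, hyz⟩ := exists_boundary_eq _ r hr _ hzs (boundary_mapDomain_toWord_eq_zero hz)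
  obtain ⟨x, rfl⟩ := exists_mapDomain_toWord_eq hy
  exact ⟨x, mapDomain_injective toWord_injective (by rw [mapDomain_toWord_IWd, hyz])⟩

end InjectiveWords

/-- **Theorem** (main result): if `r < |A|` then `H_r(C_*(A)) = 0`. -/
theorem homology_of_injective_words_complex_eq_zero_of_lt_card
    (A Γ : Type) [Fintype A] [Nonempty Γ] (r : ℕ) (hr : r < Fintype.card A) :
    Subsingleton (IWhomology A Γ r) := by
  rw [IWhomology, QuotientAddGroup.subsingleton_iff]
  exact AddSubgroup.addSubgroupOf_eq_top.2 (InjectiveWords.cycles_le_boundaries hr)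
end

section
/- Let A be a finite set with |A| = n. The augmented chain complex of the complex of injective words on A — namely the chain complex whose degree-r term (for 0 ≤ r ≤ n) is the free abelian group on the injective words (a_1, ..., a_r) of length r in A (with the unique empty word in degree 0), and whose differential sends (a_1, ..., a_r) to Σ_{i=1}^r (−1)^{i−1} (a_1, ..., â_i, ..., a_r) — has vanishing homology in every degree r ≠ n. -/
/-!
Farmer's theorem: for a finite set `A` with `|A| = n`, the augmented chain
complex of the complex of injective words on `A` (a word of length `r` placed
in degree `r`, for `0 ≤ r ≤ n`) has vanishing homology in every degree `r ≠ n`.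
-/

/-- An injective word of length `r` in `A`: a sequence `(a_1, …, a_r)` of
pairwise distinct elements of `A`. -/
def InjWord (A : Type) (r : ℕ) : Type := {f : Fin r → A // Function.Injective f}

/-- The degree-`r` part of the complex: the free abelian group on the injective
words of length `r` (for `r = 0` this is `ℤ`, generated by the empty word). -/
abbrev WChains (A : Type) (r : ℕ) : Type := InjWord A r →₀ ℤ

/-- The `i`-th face of an injective word: delete the letter `a_i`. -/
def Wface {A : Type} {r : ℕ} (i : Fin (r + 1)) (w : InjWord A (r + 1)) : InjWord A r :=
  ⟨w.1 ∘ i.succAbove, w.2.comp Fin.succAbove_right_injective⟩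

/-- The differential `d : C_{r+1} → C_r`,
`d(a_1, …, a_{r+1}) = Σ_{i=1}^{r+1} (-1)^{i-1} (a_1, …, â_i, …, a_{r+1})`. -/
noncomputable def Wd (A : Type) (r : ℕ) : WChains A (r + 1) →+ WChains A r :=
  Finsupp.liftAddHom fun w =>
    zmultiplesHom _ (∑ i : Fin (r + 1), (-1 : ℤ) ^ (i : ℕ) • Finsupp.single (Wface i w) 1)

/-- The `r`-cycles: all of degree `0`, and `ker d` in positive degrees. -/
noncomputable def Wcycles (A : Type) : (r : ℕ) → AddSubgroup (WChains A r)
  | 0 => ⊤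
  | r + 1 => (Wd A r).ker

/-- The `r`-boundaries: the image of `d : C_{r+1} → C_r`. -/
noncomputable def Wboundaries (A : Type) (r : ℕ) : AddSubgroup (WChains A r) :=
  (Wd A r).range

/-- The `r`-th homology group of the augmented chain complex of the complex of
injective words on `A`, as cycles modulo boundaries. -/
noncomputable def Whomology (A : Type) (r : ℕ) : Type :=
  Wcycles A r ⧸ (Wboundaries A r).addSubgroupOf (Wcycles A r)

open Finsupp in
/-- A linear map sends chains supported on `s` into `N` as soon as it does so on words of `s`. -/
theorem Finsupp.map_mem_of_mem_supported {α M : Type*} [AddCommGroup M] {s : Set α}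
    (f : (α →₀ ℤ) →ₗ[ℤ] M) (N : Submodule ℤ M) (h : ∀ w ∈ s, f (single w 1) ∈ N)
    {x : α →₀ ℤ} (hx : x ∈ supported ℤ ℤ s) : f x ∈ N := by
  rw [supported_eq_span_single] at hx
  have : Submodule.span ℤ ((fun i => single i (1 : ℤ)) '' s) ≤ N.comap f := by
    rw [Submodule.span_le]
    rintro _ ⟨w, hw, rfl⟩
    exact h w hw
  exact this hx

namespace ListChains

open Finsupp
open scoped List

variable {A : Type}

/-- Prepend the word `p` to every word of a chain. -/
noncomputable def prepend (p : List A) : (List A →₀ ℤ) →ₗ[ℤ] (List A →₀ ℤ) :=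
  lmapDomain ℤ ℤ (p ++ ·)

/-- Extract the part of a chain made of words beginning with `p`, and remove this beginning. -/
noncomputable def unprepend (p : List A) : (List A →₀ ℤ) →ₗ[ℤ] (List A →₀ ℤ) :=
  lcomapDomain (p ++ ·) (List.append_right_injective p)

/-- The boundary of a word, as a chain on all words. -/
noncomputable def boundaryWord : List A → (List A →₀ ℤ)
  | [] => 0
  | b :: w => single w 1 - prepend [b] (boundaryWord w)

/-- The differential on chains of arbitrary words. -/
noncomputable def boundary : (List A →₀ ℤ) →ₗ[ℤ] (List A →₀ ℤ) :=
  linearCombination ℤ boundaryWord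

@[simp] theorem prepend_single (p w : List A) (c : ℤ) :
    prepend p (single w c) = single (p ++ w) c := by
  simp [prepend]

@[simp] theorem unprepend_apply (p : List A) (x : List A →₀ ℤ) (v : List A) :
    unprepend p x v = x (p ++ v) := rfl

theorem prepend_apply_append (p : List A) (x : List A →₀ ℤ) (v : List A) :
    prepend p x (p ++ v) = x v :=
  mapDomain_apply (List.append_right_injective p) x v

theorem prepend_apply_eq_zero {p w : List A} (h : ¬ p <+: w) (x : List A →₀ ℤ) :
    prepend p x w = 0 :=
  mapDomain_of_notMem_range x w fun ⟨v, hv⟩ => h ⟨v, hv⟩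

@[simp] theorem unprepend_prepend (p : List A) (x : List A →₀ ℤ) :
    unprepend p (prepend p x) = x := by
  ext v
  simp [prepend_apply_append]

theorem unprepend_prepend_of_ne {p q : List A} (hl : p.length = q.length) (h : p ≠ q)
    (x : List A →₀ ℤ) : unprepend p (prepend q x) = 0 := by
  ext v
  rw [unprepend_apply, prepend_apply_eq_zero]
  · rfl
  · rintro ⟨t, ht⟩
    exact h (List.append_inj_left ht hl.symm).symm

theorem prepend_append (p q : List A) (x : List A →₀ ℤ) :
    prepend (p ++ q) x = prepend p (prepend q x) := by
  simp only [prepend, lmapDomain_apply, ← mapDomain_comp]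
  congr 1
  ext1 w
  simp

theorem boundary_single (w : List A) : boundary (single w 1) = boundaryWord w := by
  simp [boundary]

theorem boundary_prepend_singleton (b : A) (x : List A →₀ ℤ) :
    boundary (prepend [b] x) = x - prepend [b] (boundary x) := by
  induction x using Finsupp.induction_linear with
  | zero => simp
  | add x y hx hy => simp only [map_add, hx, hy]; abel
  | single w c =>
    have : single w c = c • single w (1 : ℤ) := by simp
    rw [this]
    simp only [map_smul, prepend_single, boundary_single, List.singleton_append, boundaryWord,
      smul_sub]

theorem prepend_mem_supported {p : List A} {s t : Set (List A)} (h : ∀ w ∈ s, p ++ w ∈ t)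
    {x : List A →₀ ℤ} (hx : x ∈ supported ℤ ℤ s) : prepend p x ∈ supported ℤ ℤ t :=
  map_mem_of_mem_supported _ _ (fun w hw => by
    rw [prepend_single]
    exact single_mem_supported ℤ 1 (h w hw)) hx

theorem boundaryWord_mem_supported (w : List A) :
    boundaryWord w ∈ supported ℤ ℤ {v | v <+ w ∧ v.length + 1 = w.length} := by
  induction w with
  | nil => exact Submodule.zero_mem _
  | cons b w ih =>
    refine Submodule.sub_mem _ (single_mem_supported ℤ 1 ?_) (prepend_mem_supported ?_ ih)
    · exact ⟨List.sublist_cons_self b w, rfl⟩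
    · rintro v ⟨hv, hl⟩
      exact ⟨hv.cons_cons b, by simpa using hl⟩

theorem boundary_mem_supported {s t : Set (List A)}
    (h : ∀ w ∈ s, ∀ v, v <+ w → v.length + 1 = w.length → v ∈ t)
    {x : List A →₀ ℤ} (hx : x ∈ supported ℤ ℤ s) : boundary x ∈ supported ℤ ℤ t :=
  map_mem_of_mem_supported _ _ (fun w hw => by
    rw [boundary_single]
    exact supported_mono (fun v hv => h w hw v hv.1 hv.2) (boundaryWord_mem_supported w)) hx

/-- Chains on words in which the letter `a` occurs only among the first `k` letters. -/
def filtration (a : A) (k : ℕ) : Submodule ℤ (List A →₀ ℤ) :=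
  supported ℤ ℤ {w | a ∉ w.drop k}

theorem boundary_mem_filtration {a : A} {k : ℕ} {x : List A →₀ ℤ} (hx : x ∈ filtration a k) :
    boundary x ∈ filtration a k :=
  boundary_mem_supported (s := {w | a ∉ w.drop k}) (t := {w | a ∉ w.drop k})
    (fun _ hw _ hv _ h => hw ((hv.drop k).subset h)) hx

theorem boundary_prepend_sub_mem_filtration (a : A) (u : List A) {x : List A →₀ ℤ}
    (hx : x ∈ filtration a 0) :
    boundary (prepend (u ++ [a]) x) - (-1 : ℤ) ^ (u.length + 1) • prepend (u ++ [a]) (boundary x)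
      ∈ filtration a u.length := by
  induction u with
  | nil => simpa [boundary_prepend_singleton] using hx
  | cons b u ih =>
    have e : b :: u ++ [a] = [b] ++ (u ++ [a]) := rfl
    rw [e, prepend_append [b], prepend_append [b], boundary_prepend_singleton]
    have h1 : prepend (u ++ [a]) x ∈ filtration a (b :: u).length :=
      prepend_mem_supported (fun w hw => by simpa using hw) hx
    have h2 : prepend [b] (boundary (prepend (u ++ [a]) x) -
        (-1 : ℤ) ^ (u.length + 1) • prepend (u ++ [a]) (boundary x)) ∈
        filtration a (b :: u).length :=
      prepend_mem_supported (fun w hw => by simpa using hw) ih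
    convert Submodule.sub_mem _ h1 h2 using 1
    rw [map_sub, map_smul, List.length_cons, pow_succ _ (u.length + 1)]
    module

theorem unprepend_eq_zero_of_mem_filtration {a : A} (u : List A) {x : List A →₀ ℤ}
    (hx : x ∈ filtration a u.length) : unprepend (u ++ [a]) x = 0 := by
  ext v
  exact (mem_supported' ℤ x).1 hx _ (by simp)

theorem exists_eq_append_of_mem_drop {a : A} {k : ℕ} {w : List A}
    (h : a ∉ w.drop (k + 1)) (h' : a ∈ w.drop k) :
    ∃ u v, u.length = k ∧ a ∉ v ∧ w = (u ++ [a]) ++ v := by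
  have hk : k < w.length := by
    by_contra hk
    simp [List.drop_eq_nil_of_le (not_lt.1 hk)] at h'
  rw [List.drop_eq_getElem_cons hk] at h'
  have ha : w[k] = a := by
    rcases List.mem_cons.1 h' with h' | h'
    · exact h'.symm
    · exact absurd h' h
  refine ⟨w.take k, w.drop (k + 1), by simp [hk.le], h, ?_⟩
  rw [List.append_assoc, ← ha, List.singleton_append, ← List.drop_eq_getElem_cons hk,
    List.take_append_drop]

theorem unprepend_boundary {a : A} (u : List A) {x : List A →₀ ℤ}
    (hx : x ∈ filtration a (u.length + 1)) :
    unprepend (u ++ [a]) (boundary x) =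
      (-1 : ℤ) ^ (u.length + 1) • boundary (unprepend (u ++ [a]) x) := by
  rw [← sub_eq_zero]
  refine map_mem_of_mem_supported
    (unprepend (u ++ [a]) ∘ₗ boundary -
      (-1 : ℤ) ^ (u.length + 1) • (boundary ∘ₗ unprepend (u ++ [a]))) ⊥ (fun w hw => ?_) hx
  simp only [LinearMap.sub_apply, LinearMap.comp_apply, LinearMap.smul_apply, Submodule.mem_bot]
  by_cases hk : a ∈ w.drop u.length
  · obtain ⟨u', v, hl, hv, rfl⟩ := exists_eq_append_of_mem_drop hw hk
    have hv' : single v (1 : ℤ) ∈ filtration a 0 := single_mem_supported ℤ 1 (by simpa using hv)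
    have key := boundary_prepend_sub_mem_filtration a u' hv'
    rw [hl] at key
    have key' := unprepend_eq_zero_of_mem_filtration u key
    rw [map_sub, map_smul, sub_eq_zero] at key'
    rw [← prepend_single, key', sub_eq_zero]
    by_cases h : u = u'
    · subst h
      rw [unprepend_prepend, unprepend_prepend]
    · have hne : u ++ [a] ≠ u' ++ [a] := fun e => h (List.append_cancel_right e)
      rw [unprepend_prepend_of_ne (by simp [hl]) hne, unprepend_prepend_of_ne (by simp [hl]) hne,
        map_zero]
  · have hw' : single w (1 : ℤ) ∈ filtration a u.length := single_mem_supported ℤ 1 hk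
    rw [unprepend_eq_zero_of_mem_filtration u hw',
      unprepend_eq_zero_of_mem_filtration u (boundary_mem_filtration hw')]
    simp

theorem sub_sum_prepend_unprepend_mem_filtration {a : A} {k : ℕ} {x : List A →₀ ℤ}
    (hx : x ∈ filtration a (k + 1)) (T : Finset (List A)) (hT : ∀ u ∈ T, u.length = k)
    (hxT : ∀ u v, u.length = k → x (u ++ [a] ++ v) ≠ 0 → u ∈ T) :
    x - ∑ u ∈ T, prepend (u ++ [a]) (unprepend (u ++ [a]) x) ∈ filtration a k := by
  classical
  refine (mem_supported' ℤ _).2 fun w hw => ?_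
  have hw : a ∈ w.drop k := not_not.1 hw
  rw [Finsupp.sub_apply, Finsupp.finsetSum_apply]
  by_cases hk : a ∈ w.drop (k + 1)
  · have h0 : x w = 0 := (mem_supported' ℤ x).1 hx w (not_not.2 hk)
    rw [h0, zero_sub, neg_eq_zero]
    refine Finset.sum_eq_zero fun u _ => ?_
    by_cases hp : u ++ [a] <+: w
    · obtain ⟨v, rfl⟩ := hp
      rw [prepend_apply_append, unprepend_apply, h0]
    · exact prepend_apply_eq_zero hp _
  · obtain ⟨u, v, hl, hv, rfl⟩ := exists_eq_append_of_mem_drop hk hw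
    rw [sub_eq_zero, Finset.sum_eq_single u, prepend_apply_append, unprepend_apply]
    · intro u' hu' hne
      refine prepend_apply_eq_zero ?_ _
      rintro ⟨t, ht⟩
      exact hne (List.append_cancel_right
        (List.append_inj_left ht (by simp [hl, hT u' hu'])))
    · intro hu
      rw [prepend_apply_append, unprepend_apply]
      by_contra h
      exact hu (hxT u v hl h)

/-- The chains on injective words of length `r` in the finite set `S`. -/
def injChains (S : Finset A) (r : ℕ) : Submodule ℤ (List A →₀ ℤ) :=
  supported ℤ ℤ {w | w.Nodup ∧ (∀ b ∈ w, b ∈ S) ∧ w.length = r}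

theorem boundary_mem_injChains {S : Finset A} {r : ℕ} {x : List A →₀ ℤ}
    (hx : x ∈ injChains S (r + 1)) : boundary x ∈ injChains S r :=
  boundary_mem_supported (s := {w | w.Nodup ∧ (∀ b ∈ w, b ∈ S) ∧ w.length = r + 1})
    (t := {w | w.Nodup ∧ (∀ b ∈ w, b ∈ S) ∧ w.length = r})
    (fun w hw v hv hl => ⟨hw.1.sublist hv, fun b hb => hw.2.1 b (hv.subset hb), by
      have := hw.2.2
      omega⟩) hx

theorem exists_boundary_eq_of_mem_filtration_one {a : A} {S : Finset A} (ha : a ∈ S) {r : ℕ}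
    {z : List A →₀ ℤ} (hz : z ∈ injChains S r) (hzF : z ∈ filtration a 1) (hd : boundary z = 0) :
    ∃ y ∈ injChains S (r + 1), boundary y = z := by
  have hdv := unprepend_boundary [] hzF
  simp only [hd, map_zero, List.nil_append, List.length_nil, zero_add, pow_one, neg_smul, one_smul,
    zero_eq_neg] at hdv
  have hw := sub_sum_prepend_unprepend_mem_filtration hzF {[]} (by simp)
    (by simp +contextual)
  simp only [Finset.sum_singleton, List.nil_append] at hw
  set v := unprepend [a] z
  refine ⟨prepend [a] (z - prepend [a] v), ?_, ?_⟩
  · have hwz : z - prepend [a] v ∈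
        supported ℤ ℤ {w | a ∉ w ∧ w.Nodup ∧ (∀ b ∈ w, b ∈ S) ∧ w.length = r} := by
      refine (mem_supported' ℤ _).2 fun w hw' => ?_
      by_cases haw : a ∈ w
      · exact (mem_supported' ℤ _).1 hw w (by simpa using haw)
      · rw [Finsupp.sub_apply, prepend_apply_eq_zero (fun h => haw (h.subset (by simp))),
          sub_zero]
        exact (mem_supported' ℤ _).1 hz w fun h => hw' ⟨haw, h⟩
    refine prepend_mem_supported ?_ hwz
    rintro w ⟨haw, hn, hS, hl⟩
    exact ⟨by simp [haw, hn], by simpa [ha] using hS, by simp [hl]⟩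
  · rw [boundary_prepend_singleton, map_sub, hd, boundary_prepend_singleton, hdv]
    simp

theorem exists_sub_boundary_mem_filtration {a : A} {S : Finset A} {r : ℕ}
    (hr : r < S.card)
    (ih : ∀ T : Finset A, T.card < S.card → ∀ q < T.card, ∀ z ∈ injChains T q, boundary z = 0 →
      ∃ y ∈ injChains T (q + 1), boundary y = z)
    {k : ℕ} {z : List A →₀ ℤ} (hz : z ∈ injChains S r) (hzF : z ∈ filtration a (k + 1))
    (hd : boundary z = 0) :
    ∃ y ∈ injChains S (r + 1), z - boundary y ∈ filtration a k := by
  classical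
  have hu : ∀ u : List A, u.length = k → ∃ y ∈ filtration a 0,
      boundary y = unprepend (u ++ [a]) z ∧ prepend (u ++ [a]) y ∈ injChains S (r + 1) := by
    intro u hk
    by_cases h0 : unprepend (u ++ [a]) z = 0
    · exact ⟨0, Submodule.zero_mem _, by simp [h0], by simp⟩
    obtain ⟨v, hv⟩ := Finsupp.ne_iff.1 h0
    have hv : (u ++ [a] ++ v).Nodup ∧ (∀ b ∈ u ++ [a] ++ v, b ∈ S) ∧
        (u ++ [a] ++ v).length = r := by
      by_contra h
      exact hv ((mem_supported' ℤ z).1 hz _ h)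
    obtain ⟨hn, hS, hl⟩ := hv
    have hpn : (u ++ [a]).Nodup := hn.sublist (List.sublist_append_left _ _)
    have hpS : (u ++ [a]).toFinset ⊆ S := fun b hb =>
      hS b (List.mem_append_left _ (List.mem_toFinset.1 hb))
    have hcard := Finset.card_sdiff_add_card_eq_card hpS
    rw [List.toFinset_card_of_nodup hpn] at hcard
    simp only [List.length_append, List.length_singleton] at hcard hl
    obtain ⟨y, hy, hyz⟩ := ih (S \ (u ++ [a]).toFinset) (by omega) v.length (by omega)
      (unprepend (u ++ [a]) z) (by
        refine (mem_supported' ℤ _).2 fun w hw => ?_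
        refine (mem_supported' ℤ z).1 hz _ fun ⟨hwn, hwS, hwl⟩ => hw ⟨?_, ?_, ?_⟩
        · exact hwn.sublist (List.sublist_append_right _ _)
        · intro b hb
          rw [Finset.mem_sdiff, List.mem_toFinset]
          exact ⟨hwS b (List.mem_append_right _ hb),
            fun h => (List.nodup_append.1 hwn).2.2 b h b hb rfl⟩
        · simp only [List.length_append, List.length_singleton] at hwl
          omega) (by
        have := unprepend_boundary u (hk ▸ hzF)
        rw [hd, map_zero] at this
        exact (smul_eq_zero.1 this.symm).resolve_left (by simp))
    refine ⟨y, ?_, hyz, ?_⟩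
    · refine supported_mono ?_ hy
      rintro w ⟨-, hw, -⟩ haw
      simpa using hw a haw
    · refine prepend_mem_supported ?_ hy
      rintro w ⟨hwn, hwS, hwl⟩
      have hwS : ∀ b ∈ w, b ∈ S ∧ b ∉ u ++ [a] := fun b hb => by
        simpa only [Finset.mem_sdiff, List.mem_toFinset] using hwS b hb
      refine ⟨List.nodup_append.2 ⟨hpn, hwn, ?_⟩, ?_, ?_⟩
      · rintro b hb c hc rfl
        exact (hwS b hc).2 hb
      · intro b hb
        rcases List.mem_append.1 hb with hb | hb
        · exact hpS (List.mem_toFinset.2 hb)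
        · exact (hwS b hb).1
      · simp only [List.length_append, List.length_singleton]
        omega
  choose! y hyF hyz hyS using hu
  let T : Finset (List A) := (z.support.image (List.take k)).filter (·.length = k)
  have hT : ∀ u ∈ T, u.length = k := fun u hu => (Finset.mem_filter.1 hu).2
  refine ⟨∑ u ∈ T, (-1 : ℤ) ^ (k + 1) • prepend (u ++ [a]) (y u),
    Submodule.sum_mem _ fun u hu => Submodule.smul_mem _ _ (hyS u (hT u hu)), ?_⟩
  have h1 := sub_sum_prepend_unprepend_mem_filtration hzF T hT (fun u v hl h => by
    refine Finset.mem_filter.2 ⟨Finset.mem_image.2 ⟨_, Finsupp.mem_support_iff.2 h, ?_⟩, hl⟩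
    rw [List.append_assoc, List.take_left' hl])
  have h2 : ∑ u ∈ T, (-1 : ℤ) ^ (k + 1) • (boundary (prepend (u ++ [a]) (y u)) -
      (-1 : ℤ) ^ (k + 1) • prepend (u ++ [a]) (boundary (y u))) ∈ filtration a k := by
    refine Submodule.sum_mem _ fun u hu => Submodule.smul_mem _ _ ?_
    have := boundary_prepend_sub_mem_filtration a u (hyF u (hT u hu))
    rwa [hT u hu] at this
  convert Submodule.sub_mem _ h1 h2 using 1
  rw [map_sum, sub_sub, ← Finset.sum_add_distrib]
  congr 1
  refine Finset.sum_congr rfl fun u hu => ?_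
  rw [hyz u (hT u hu), map_smul, smul_sub, smul_smul, ← mul_pow]
  simp

theorem boundary_boundary (x : List A →₀ ℤ) : boundary (boundary x) = 0 := by
  induction x using Finsupp.induction_linear with
  | zero => simp
  | add x y hx hy => simp only [map_add, hx, hy, add_zero]
  | single w c =>
    have : single w c = c • single w (1 : ℤ) := by simp
    rw [this, map_smul, map_smul, boundary_single]
    suffices h : boundary (boundaryWord w) = 0 by rw [h, smul_zero]
    induction w with
    | nil => simp [boundaryWord]
    | cons b w ih =>
      rw [boundaryWord, map_sub, boundary_single, boundary_prepend_singleton, ih (by simp)]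
      simp

/-- Cycles on injective words of length `r < |S|` in `S` are boundaries. -/
theorem exists_boundary_eq (S : Finset A) {r : ℕ} (hr : r < S.card) {z : List A →₀ ℤ}
    (hz : z ∈ injChains S r) (hd : boundary z = 0) :
    ∃ y ∈ injChains S (r + 1), boundary y = z := by
  induction hm : S.card using Nat.strong_induction_on generalizing S r z with
  | _ m ih =>
    subst hm
    obtain ⟨a, ha⟩ := Finset.card_pos.1 (Nat.zero_lt_of_lt hr)
    have key : ∀ k, ∀ z ∈ injChains S r, z ∈ filtration a (k + 1) → boundary z = 0 →
        ∃ y ∈ injChains S (r + 1), boundary y = z := by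
      intro k
      induction k with
      | zero =>
        intro z hz hzF hd
        exact exists_boundary_eq_of_mem_filtration_one ha hz hzF hd
      | succ k ihk =>
        intro z hz hzF hd
        obtain ⟨y, hy, hyF⟩ := exists_sub_boundary_mem_filtration hr
          (fun T hT q hq z hz hd => ih T.card hT T hq hz hd rfl) hz hzF hd
        obtain ⟨y', hy', h⟩ := ihk (z - boundary y)
          (Submodule.sub_mem _ hz (boundary_mem_injChains hy)) hyF
          (by rw [map_sub, hd, boundary_boundary, sub_zero])
        exact ⟨y' + y, Submodule.add_mem _ hy' hy, by rw [map_add, h, sub_add_cancel]⟩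
    refine key r z hz (supported_mono ?_ hz) hd
    rintro w ⟨-, -, hl⟩
    simp [List.drop_eq_nil_of_le (show w.length ≤ r + 1 by omega)]

theorem boundaryWord_ofFn {r : ℕ} (f : Fin (r + 1) → A) :
    boundaryWord (List.ofFn f) =
      ∑ i : Fin (r + 1), (-1 : ℤ) ^ (i : ℕ) • single (List.ofFn (f ∘ i.succAbove)) 1 := by
  induction r with
  | zero => simp [boundaryWord]
  | succ r ih =>
    rw [List.ofFn_succ, boundaryWord, ih, Fin.sum_univ_succ (n := r + 1), map_sum, sub_eq_add_neg,
      ← Finset.sum_neg_distrib]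
    congr 1
    · simp [Function.comp_def]
    · refine Finset.sum_congr rfl fun i _ => ?_
      rw [map_smul, prepend_single, Fin.val_succ, pow_succ, mul_neg_one, neg_smul]
      congr 3
      rw [List.ofFn_succ]
      simp [Function.comp_def]

/-- Injective words, seen as lists. -/
def wordToList {r : ℕ} (w : InjWord A r) : List A := List.ofFn w.1

theorem wordToList_injective {r : ℕ} : Function.Injective (wordToList (A := A) (r := r)) :=
  fun _ _ h => Subtype.ext (List.ofFn_injective h)

/-- Chains on injective words, seen as chains on lists. -/
noncomputable def toListChains (r : ℕ) : WChains A r →ₗ[ℤ] (List A →₀ ℤ) :=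
  lmapDomain ℤ ℤ wordToList

theorem toListChains_injective (r : ℕ) : Function.Injective (toListChains (A := A) r) :=
  mapDomain_injective wordToList_injective

theorem boundary_toListChains {r : ℕ} (x : WChains A (r + 1)) :
    boundary (toListChains (r + 1) x) = toListChains r (Wd A r x) := by
  induction x using Finsupp.induction_linear with
  | zero => simp
  | add x y hx hy => simp only [map_add, hx, hy]
  | single w c =>
    have : single w c = c • single w (1 : ℤ) := by simp
    rw [this, map_smul, map_smul, map_zsmul, map_smul]
    congr 1
    simp only [toListChains, lmapDomain_apply, mapDomain_single, boundary_single, Wd,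
      liftAddHom_apply_single, zmultiplesHom_apply, one_smul]
    rw [← lmapDomain_apply ℤ ℤ, map_sum, wordToList, boundaryWord_ofFn]
    refine Finset.sum_congr rfl fun i _ => ?_
    rw [map_smul, lmapDomain_apply, mapDomain_single]
    rfl

theorem range_toListChains [Fintype A] (r : ℕ) :
    LinearMap.range (toListChains (A := A) r) = injChains Finset.univ r := by
  rw [toListChains, range_lmapDomain, injChains, supported_eq_span_single]
  congr 1
  ext x
  simp only [Set.mem_range, Set.mem_image, Set.mem_ofPred_eq]
  constructor
  · rintro ⟨w, rfl⟩
    exact ⟨wordToList w, ⟨List.nodup_ofFn.2 w.2, by simp, by simp [wordToList]⟩, rfl⟩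
  · rintro ⟨l, ⟨hn, -, rfl⟩, rfl⟩
    exact ⟨⟨l.get, List.nodup_iff_injective_get.1 hn⟩, by simp [wordToList]⟩

end ListChains

open ListChains in
theorem Wcycles_le_Wboundaries (A : Type) [Fintype A] {r : ℕ} (hr : r < Fintype.card A) :
    Wcycles A r ≤ Wboundaries A r := by
  intro z hz
  have hmem : toListChains r z ∈ injChains Finset.univ r :=
    range_toListChains (A := A) r ▸ LinearMap.mem_range_self _ z
  have hd : boundary (toListChains r z) = 0 := by
    cases r with
    | zero =>
      refine Finsupp.map_mem_of_mem_supported boundary ⊥ ?_ hmem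
      rintro w ⟨-, -, hl⟩
      simp [List.length_eq_zero_iff.1 hl, boundary_single, boundaryWord]
    | succ r =>
      have hz : Wd A r z = 0 := hz
      rw [boundary_toListChains, hz, map_zero]
  obtain ⟨y, hy, hyz⟩ := exists_boundary_eq Finset.univ (by simpa using hr) hmem hd
  rw [← range_toListChains] at hy
  obtain ⟨x, rfl⟩ := hy
  exact ⟨x, toListChains_injective r (by rw [← boundary_toListChains, hyz])⟩

theorem InjWord.isEmpty_of_card_lt (A : Type) [Fintype A] {r : ℕ} (hr : Fintype.card A < r) :
    IsEmpty (InjWord A r) :=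
  ⟨fun w => hr.not_ge (by simpa using Fintype.card_le_of_injective w.1 w.2)⟩

/-- **Farmer's theorem**: for a finite set `A` with `|A| = n`, the augmented
chain complex of the complex of injective words on `A` has vanishing homology
in every degree `r ≠ n`. -/
theorem homology_of_complex_of_injective_words_eq_zero_of_ne_card
    (A : Type) [Fintype A] (n : ℕ) (hn : Fintype.card A = n)
    (r : ℕ) (hr : r ≠ n) : Subsingleton (Whomology A r) := by
  have hle : Wcycles A r ≤ Wboundaries A r := by
    rcases lt_or_gt_of_ne (hn ▸ hr) with h | h
    · exact Wcycles_le_Wboundaries A h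
    · have := InjWord.isEmpty_of_card_lt A h
      intro z _
      rw [Subsingleton.elim z 0]
      exact zero_mem _
  exact QuotientAddGroup.subsingleton_iff.2 (AddSubgroup.addSubgroupOf_eq_top.2 hle)
end

section
/- Let A be a finite set with |A| = n ≥ 1 and let Γ be an infinite set. Then the top homology group H_n(C_*(A)) is a free abelian group of infinite rank; in particular, it is not finitely generated. -/
noncomputable instance (A Γ : Type) (r : ℕ) : AddCommGroup (IWhomology A Γ r) :=
  inferInstanceAs (AddCommGroup (_ ⧸ _))

/-- A submodule of `ι →₀ R` over a principal ideal domain `R` is free, of any rank: choose one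
element for each leading coefficient ideal that is not zero. -/
theorem Submodule.free_of_finsupp_of_wellFoundedLT {ι R : Type*} [LinearOrder ι] [WellFoundedLT ι]
    [CommRing R] [IsDomain R] [IsPrincipalIdealRing R] (N : Submodule R (ι →₀ R)) :
    Module.Free R N := by
  classical
  let F (i : ι) : Submodule R (ι →₀ R) := N ⊓ Finsupp.supported R R (Set.Iic i)
  let I (i : ι) : Ideal R := (F i).map (Finsupp.lapply i)
  have hy (i : ι) : ∃ y ∈ F i, y i = Submodule.IsPrincipal.generator (I i) :=
    Submodule.IsPrincipal.generator_mem (I i)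
  choose y hyF hyc using hy
  let v (i : {i : ι // y i i ≠ 0}) : N := ⟨y i, (hyF i).1⟩
  have hlt {i j : ι} (h : j < i) : y j i = 0 := by
    by_contra hne
    exact h.not_ge ((Finsupp.mem_supported _ _).1 (hyF j).2 (by simpa using hne))
  have hli : LinearIndependent R v := by
    refine .of_comp N.subtype (linearIndependent_iff'.2 fun s g hg => ?_)
    by_contra! hne
    obtain ⟨i, hi, hmax⟩ := (s.filter (g · ≠ 0)).exists_max_image id
      (hne.imp fun i h => Finset.mem_filter.2 h)
    rw [Finset.mem_filter] at hi
    have h := DFunLike.congr_fun hg i.1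
    rw [Finsupp.finsetSum_apply, Finset.sum_eq_single_of_mem i hi.1] at h
    · exact (mul_ne_zero hi.2 i.2) (by simpa [v] using h)
    · intro j hj hji
      rcases lt_or_gt_of_ne hji with hlt' | hgt
      · simp [v, hlt hlt']
      · have : g j = 0 := by
          by_contra hgj
          exact hgt.not_ge (hmax j (Finset.mem_filter.2 ⟨hj, hgj⟩))
        simp [this]
  have hF (i : ι) : ∀ x (hx : x ∈ F i), ⟨x, hx.1⟩ ∈ span R (Set.range v) := by
    induction i using WellFoundedLT.induction with
    | ind i ih =>
    have key (x : ι →₀ R) (hx : x ∈ F i) (hxi : x i = 0) :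
        ⟨x, hx.1⟩ ∈ span R (Set.range v) := by
      rcases x.support.eq_empty_or_nonempty with h0 | hne
      · obtain rfl := Finsupp.support_eq_empty.1 h0
        exact zero_mem _
      · have hmem := x.support.max'_mem hne
        have hle : x.support.max' hne ≤ i := (Finsupp.mem_supported _ _).1 hx.2 hmem
        refine ih _ (hle.lt_of_ne fun h => ?_) x
          ⟨hx.1, (Finsupp.mem_supported _ _).2 fun j hj => x.support.le_max' j hj⟩
        exact Finsupp.mem_support_iff.1 (h ▸ hmem) hxi
    intro x hx
    obtain ⟨t, ht⟩ := (Submodule.IsPrincipal.mem_iff_eq_smul_generator (I i)).1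
      (⟨x, hx, rfl⟩ : x i ∈ I i)
    rw [← hyc, smul_eq_mul] at ht
    by_cases h0 : y i i = 0
    · exact key x hx (by simp [ht, h0])
    · have h := key (x - t • y i) (sub_mem hx ((F i).smul_mem t (hyF i))) (by simp [ht])
      have hv : v ⟨i, h0⟩ ∈ span R (Set.range v) := subset_span ⟨_, rfl⟩
      convert add_mem h (smul_mem _ t hv) using 1
      ext1
      simp [v]
  refine .of_basis (.mk hli fun x _ => ?_)
  rcases x.1.support.eq_empty_or_nonempty with h0 | hne
  · have : x = 0 := Subtype.ext (Finsupp.support_eq_empty.1 h0)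
    exact this ▸ zero_mem _
  · exact hF (x.1.support.max' hne) x.1
      ⟨x.2, (Finsupp.mem_supported _ _).2 fun j hj => x.1.support.le_max' j hj⟩

/-- A submodule of a free module over a principal ideal domain is free. -/
theorem Submodule.free_of_free_of_pid {R M : Type*} [CommRing R] [IsDomain R]
    [IsPrincipalIdealRing R] [AddCommGroup M] [Module R M] [Module.Free R M]
    (N : Submodule R M) : Module.Free R N := by
  let b := Module.Free.chooseBasis R M
  obtain ⟨_, _⟩ := exists_wellFoundedLT (Module.Free.ChooseBasisIndex R M)
  have := Submodule.free_of_finsupp_of_wellFoundedLT (N.map b.repr.toLinearMap)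
  exact .of_equiv (b.repr.submoduleMap N).symm

/-- The generator with letters `a` whose `i`-th color is `γ` if `ε i` holds and `b` otherwise. -/
def IWGen.twoColored {A Γ : Type} {r : ℕ} (a : Fin r ↪ A) (b γ : Γ) (ε : Fin r → Bool) :
    IWGen A Γ r where
  letters := a
  inj := a.injective
  colors i := if ε i then γ else b

/-- The cross-polytope chain: the concatenation product of the cycles `(a i, b) - (a i, γ)`. -/
noncomputable def crossPolytope {A Γ : Type} {r : ℕ} (a : Fin r ↪ A) (b γ : Γ) : IWChains A Γ r :=
  ∑ ε : Fin r → Bool,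
    (∏ i, if ε i then (-1 : ℤ) else 1) • Finsupp.single (IWGen.twoColored a b γ ε) 1

theorem IWface_twoColored_insertNth {A Γ : Type} {r : ℕ} (a : Fin (r + 1) ↪ A) (b γ : Γ)
    (i : Fin (r + 1)) (x : Bool) (ε : Fin r → Bool) :
    IWface i (IWGen.twoColored a b γ (i.insertNth x ε)) =
      IWGen.twoColored (i.succAboveEmb.trans a) b γ ε := by
  simp only [IWface, IWGen.twoColored, IWGen.mk.injEq]
  refine ⟨rfl, ?_⟩
  ext j
  simp

theorem IWd_single {A Γ : Type} {r : ℕ} (g : IWGen A Γ (r + 1)) :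
    IWd A Γ r (Finsupp.single g 1) =
      ∑ i : Fin (r + 1), (-1 : ℤ) ^ (i : ℕ) • Finsupp.single (IWface i g) 1 := by
  simp [IWd]

theorem IWd_crossPolytope {A Γ : Type} {r : ℕ} (a : Fin (r + 1) ↪ A) (b γ : Γ) :
    IWd A Γ r (crossPolytope a b γ) = 0 := by
  simp only [crossPolytope, map_sum, map_zsmul, IWd_single, Finset.smul_sum]
  rw [Finset.sum_comm]
  refine Finset.sum_eq_zero fun i _ => ?_
  rw [← (Fin.insertNthEquiv (fun _ => Bool) i).sum_comp, Fintype.sum_prod_type]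
  simp [Fin.insertNthEquiv, Fin.prod_univ_succAbove _ i, IWface_twoColored_insertNth]

theorem twoColored_eq_twoColored_true_iff {A Γ : Type} {r : ℕ} (a : Fin (r + 1) ↪ A) {b γ δ : Γ}
    (hδ : δ ≠ b) (ε : Fin (r + 1) → Bool) :
    IWGen.twoColored a b γ ε = IWGen.twoColored a b δ (fun _ => true) ↔
      γ = δ ∧ ε = fun _ => true := by
  refine ⟨fun h => ?_, fun ⟨h, h'⟩ => h ▸ h' ▸ rfl⟩
  have hc (i : Fin (r + 1)) : (if ε i then γ else b) = δ := by
    simpa [IWGen.twoColored] using congrFun (congrArg IWGen.colors h) i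
  have hε (i : Fin (r + 1)) : ε i = true := by
    by_contra hi
    exact hδ (by simpa [hi] using (hc i).symm)
  exact ⟨by simpa [hε] using hc 0, funext hε⟩

open Classical in
theorem crossPolytope_apply {A Γ : Type} {r : ℕ} (a : Fin (r + 1) ↪ A) {b γ δ : Γ} (hδ : δ ≠ b) :
    crossPolytope a b γ (IWGen.twoColored a b δ fun _ => true) =
      if γ = δ then (-1) ^ (r + 1) else 0 := by
  simp only [crossPolytope, Finsupp.finsetSum_apply, Finsupp.smul_apply, Finsupp.single_apply,
    twoColored_eq_twoColored_true_iff a hδ]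
  split_ifs with h <;> simp [h]

theorem linearIndependent_crossPolytope {A Γ : Type} {r : ℕ} (a : Fin (r + 1) ↪ A) (b : Γ) :
    LinearIndependent ℤ fun γ : {γ : Γ // γ ≠ b} => crossPolytope a b γ.1 := by
  classical
  rw [linearIndependent_iff']
  intro s g hg δ hδ
  have h := DFunLike.congr_fun hg (IWGen.twoColored a b δ.1 fun _ => true)
  simpa [Finsupp.finsetSum_apply, crossPolytope_apply a δ.2, Subtype.val_inj, hδ] using h

theorem IWboundaries_eq_bot (A Γ : Type) [Fintype A] {r : ℕ} (h : Fintype.card A ≤ r) :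
    IWboundaries A Γ r = ⊥ := by
  have : IsEmpty (IWGen A Γ (r + 1)) :=
    ⟨fun g => by simpa using (Fintype.card_le_of_injective _ g.inj).trans h⟩
  rw [IWboundaries, AddMonoidHom.range_eq_bot_iff]
  ext x
  exact isEmptyElim x

/-- In degrees at least `|A|` the homology is the group of cycles. -/
noncomputable def IWhomologyEquivCycles (A Γ : Type) [Fintype A] {r : ℕ}
    (h : Fintype.card A ≤ r) :
    IWhomology A Γ r ≃ₗ[ℤ] AddSubgroup.toIntSubmodule (IWcycles A Γ r) :=
  AddEquiv.toIntLinearEquiv <|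
    (QuotientAddGroup.quotientAddEquivOfEq
      (by rw [IWboundaries_eq_bot A Γ h, AddSubgroup.bot_addSubgroupOf])).trans
    QuotientAddGroup.quotientBot

/-- **Theorem**: if `|A| = n ≥ 1` and `Γ` is infinite, then the top homology
group `H_n(C_*(A))` is a free abelian group of infinite rank; in particular it
is not finitely generated. -/
theorem top_homology_free_of_infinite_rank
    (A Γ : Type) [Fintype A] [Infinite Γ] (n : ℕ) (hn : Fintype.card A = n)
    (h1 : 1 ≤ n) :
    Module.Free ℤ (IWhomology A Γ n) ∧
      Cardinal.aleph0 ≤ Module.rank ℤ (IWhomology A Γ n) ∧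
      ¬ Module.Finite ℤ (IWhomology A Γ n) := by
  obtain ⟨r, rfl⟩ : ∃ r, n = r + 1 := ⟨n - 1, by lia⟩
  have e := IWhomologyEquivCycles A Γ hn.le
  let a : Fin (r + 1) ↪ A := (Fintype.equivFinOfCardEq hn).symm.toEmbedding
  obtain ⟨b⟩ : Nonempty Γ := inferInstance
  have hli : LinearIndependent ℤ fun γ : {γ : Γ // γ ≠ b} =>
      (⟨crossPolytope a b γ.1, IWd_crossPolytope a b γ.1⟩ :
        AddSubgroup.toIntSubmodule (IWcycles A Γ (r + 1))) :=
    .of_comp (Submodule.subtype _) (linearIndependent_crossPolytope a b)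
  have hinf : Infinite {γ : Γ // γ ≠ b} := (Set.finite_singleton b).infinite_compl.to_subtype
  have hrank : Cardinal.aleph0 ≤ Module.rank ℤ (IWhomology A Γ (r + 1)) := by
    rw [e.rank_eq]
    exact (Cardinal.aleph0_le_mk _).trans hli.cardinal_le_rank
  have := (AddSubgroup.toIntSubmodule (IWcycles A Γ (r + 1))).free_of_free_of_pid
  exact ⟨.of_equiv e.symm, hrank, fun _ => hrank.not_gt (Module.rank_lt_aleph0 ℤ _)⟩
end

section
/- Let A be a finite set with |A| = n ≥ 1 and let Γ be a finite nonempty set with |Γ| = ℓ. Then the top homology group H_n(C_*(A)) is a free abelian group of rank d(ℓ)_n, where d(ℓ)_n := Σ_{i=0}^n (−1)^i (n!/i!) ℓ^{n−i}. -/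
/-- `d(ℓ)_n := Σ_{i=0}^n (-1)^i (n!/i!) ℓ^(n-i)`. -/
def dln (ℓ n : ℕ) : ℤ :=
  ∑ i ∈ Finset.range (n + 1),
    (-1 : ℤ) ^ i * ((Nat.factorial n / Nat.factorial i : ℕ) : ℤ) * (ℓ : ℤ) ^ (n - i)

/-- The free abelian group on all words in the alphabet `X`. -/
abbrev WordModule (X : Type) : Type := List X →₀ ℤ

namespace WordModule

variable {X : Type}

/-- The alternating sum of all one-letter deletions of a word. -/
noncomputable def deletions (w : List X) : WordModule X :=
  ∑ i ∈ Finset.range w.length, (-1 : ℤ) ^ i • Finsupp.single (w.eraseIdx i) 1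

/-- The deletion differential on all words. -/
noncomputable def del : WordModule X →ₗ[ℤ] WordModule X :=
  Finsupp.linearCombination ℤ deletions

/-- Left concatenation with the word `q`. -/
noncomputable def prepend (q : List X) : WordModule X →ₗ[ℤ] WordModule X :=
  Finsupp.lmapDomain ℤ ℤ (q ++ ·)

/-- The part of a chain with prefix `q`, with that prefix removed. -/
noncomputable def strip (q : List X) : WordModule X →ₗ[ℤ] WordModule X :=
  Finsupp.lcomapDomain (q ++ ·) (List.append_right_injective q)

@[simp] lemma del_single (w : List X) : del (Finsupp.single w 1) = deletions w := by
  simp [del]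

@[simp] lemma prepend_single (q w : List X) (c : ℤ) :
    prepend q (Finsupp.single w c) = Finsupp.single (q ++ w) c := by
  simp [prepend]

lemma strip_apply (q v : List X) (z : WordModule X) : strip q z v = z (q ++ v) := rfl

lemma strip_single_append (q v : List X) :
    strip q (Finsupp.single (q ++ v) 1) = Finsupp.single v 1 := by
  classical
  ext u
  simp [strip_apply, Finsupp.single_apply]

lemma strip_single_eq_zero {q w : List X} (h : ¬ q <+: w) :
    strip q (Finsupp.single w 1) = 0 := by
  classical
  ext u
  rw [strip_apply, Finsupp.single_apply, if_neg]
  · rfl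
  · rintro rfl
    exact h (List.prefix_append q u)

lemma prepend_apply (q w : List X) (z : WordModule X) [DecidableEq X] :
    prepend q z w = if w.take q.length = q then z (w.drop q.length) else 0 := by
  split_ifs with h
  · obtain ⟨v, rfl⟩ : q <+: w := by
      rw [List.prefix_iff_eq_take]; exact h.symm
    simp only [List.drop_left]
    exact Finsupp.mapDomain_apply (List.append_right_injective q) z v
  · refine Finsupp.mapDomain_of_notMem_range z w ?_
    rintro ⟨v, rfl⟩
    exact h (by simp)

/-- Linear maps agreeing on the words of `s` agree on chains supported in `s`. -/
lemma eqOn_supported {N : Type*} [AddCommGroup N] {s : Set (List X)}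
    {f g : WordModule X →ₗ[ℤ] N}
    (h : ∀ w ∈ s, f (Finsupp.single w 1) = g (Finsupp.single w 1))
    {z : WordModule X} (hz : z ∈ Finsupp.supported ℤ ℤ s) : f z = g z := by
  rw [Finsupp.supported_eq_span_single] at hz
  refine LinearMap.eqOn_span (f := f) (g := g) ?_ hz
  rintro _ ⟨w, hw, rfl⟩
  exact h w hw

/-- A linear map sending the words of `s` into `T` sends chains supported in `s` into `T`. -/
lemma map_mem_of_supported {s : Set (List X)} {T : Submodule ℤ (WordModule X)}
    {f : WordModule X →ₗ[ℤ] WordModule X}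
    (h : ∀ w ∈ s, f (Finsupp.single w 1) ∈ T)
    {z : WordModule X} (hz : z ∈ Finsupp.supported ℤ ℤ s) : f z ∈ T := by
  rw [Finsupp.supported_eq_span_single] at hz
  have : Submodule.span ℤ ((fun i => Finsupp.single i (1 : ℤ)) '' s) ≤ T.comap f := by
    rw [Submodule.span_le]
    rintro _ ⟨w, hw, rfl⟩
    exact h w hw
  exact this hz

lemma deletions_append (q v : List X) :
    deletions (q ++ v) =
      (∑ i ∈ Finset.range q.length, (-1 : ℤ) ^ i • Finsupp.single (q.eraseIdx i ++ v) 1) +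
        (-1 : ℤ) ^ q.length • prepend q (deletions v) := by
  rw [deletions, List.length_append, Finset.sum_range_add]
  congr 1
  · refine Finset.sum_congr rfl fun i hi => ?_
    rw [List.eraseIdx_append_of_lt_length (Finset.mem_range.1 hi)]
  · rw [deletions, map_sum, Finset.smul_sum]
    refine Finset.sum_congr rfl fun i _ => ?_
    rw [map_smul, prepend_single, smul_smul, pow_add,
      List.eraseIdx_append_of_length_le (by omega)]
    simp

lemma del_prepend_letter (x : X) (z : WordModule X) :
    del (prepend [x] z) = z - prepend [x] (del z) := by
  have h : del ∘ₗ prepend [x] = LinearMap.id - prepend [x] ∘ₗ del := by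
    refine Finsupp.lhom_ext' fun w => LinearMap.ext_ring ?_
    simp only [LinearMap.comp_apply, Finsupp.lsingle_apply, prepend_single, del_single,
      LinearMap.sub_apply, LinearMap.id_apply]
    rw [deletions_append]
    simp [sub_eq_add_neg]
  exact LinearMap.congr_fun h z

lemma del_del (z : WordModule X) : del (del z) = 0 := by
  have h : (del ∘ₗ del : WordModule X →ₗ[ℤ] WordModule X) = 0 := by
    refine Finsupp.lhom_ext' fun w => LinearMap.ext_ring ?_
    simp only [LinearMap.comp_apply, Finsupp.lsingle_apply, LinearMap.zero_apply]
    induction w with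
    | nil => simp [deletions]
    | cons x w ih =>
      have : (Finsupp.single (x :: w) 1 : WordModule X) = prepend [x] (Finsupp.single w 1) := by
        simp
      rw [this, del_prepend_letter, map_sub, del_prepend_letter, ih]
      simp
  exact LinearMap.congr_fun h z

variable {A Γ : Type}

/-- Words of length `r` whose letters are pairwise distinct elements of `S`. -/
def injWords (Γ : Type) (S : Finset A) (r : ℕ) : Set (List (A × Γ)) :=
  {w | w.length = r ∧ (w.map Prod.fst).Nodup ∧ ∀ x ∈ w, x.1 ∈ S}

/-- Words in which the letter `a` does not occur at position `p` or later. -/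
def avoidFrom (Γ : Type) (a : A) (p : ℕ) : Set (List (A × Γ)) :=
  {w | a ∉ (w.drop p).map Prod.fst}

lemma not_prefix_eraseIdx {a : A} {p i : ℕ} {q w : List (A × Γ)} (hq : q.length = p + 1)
    (ha : a ∈ (q.drop p).map Prod.fst) (hw : w ∈ avoidFrom Γ a (p + 1)) (hi : i ≤ p) :
    ¬ q <+: w.eraseIdx i := by
  rintro ⟨v, hv⟩
  apply hw
  have h : w.drop (p + 1) = (q ++ v).drop p := by
    rw [hv, List.eraseIdx_eq_take_drop_succ, List.drop_append]
    by_cases hl : i ≤ w.length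
    · rw [List.drop_eq_nil_of_le (as := w.take i) (by rw [List.length_take]; omega), List.nil_append,
        List.drop_drop, List.length_take, Nat.min_eq_left hl]
      congr 1
      omega
    · have := congrArg List.length hv
      rw [List.eraseIdx_of_length_le (by omega)] at this
      rw [List.length_append] at this
      omega
  rw [h, List.drop_append_of_le_length (by omega), List.map_append]
  exact List.mem_append_left _ ha

lemma prefix_of_prefix_eraseIdx {p i : ℕ} {q w : List (A × Γ)} (hq : q.length = p + 1)
    (hi : p + 1 ≤ i) (h : q <+: w.eraseIdx i) : q <+: w := by
  refine List.IsPrefix.trans ?_ (List.take_prefix i w)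
  rw [List.eraseIdx_eq_take_drop_succ] at h
  have hl : i ≤ w.length ∨ w.length < i := by omega
  rcases hl with hl | hl
  · exact List.prefix_of_prefix_length_le h (List.prefix_append _ _) (by simp; omega)
  · rw [List.drop_eq_nil_of_le (by omega), List.append_nil] at h
    exact h

lemma strip_del {a : A} {p : ℕ} {q : List (A × Γ)} (hq : q.length = p + 1)
    (ha : a ∈ (q.drop p).map Prod.fst) {z : WordModule (A × Γ)}
    (hz : z ∈ Finsupp.supported ℤ ℤ (avoidFrom Γ a (p + 1))) :
    strip q (del z) = (-1 : ℤ) ^ (p + 1) • del (strip q z) := by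
  refine eqOn_supported (f := strip q ∘ₗ del) (g := (-1 : ℤ) ^ (p + 1) • (del ∘ₗ strip q))
    (fun w hw => ?_) hz
  simp only [LinearMap.comp_apply, LinearMap.smul_apply, del_single]
  by_cases h : q <+: w
  · obtain ⟨v, rfl⟩ := h
    rw [strip_single_append, del_single, deletions_append, map_add, map_sum,
      Finset.sum_eq_zero, zero_add, map_smul, hq]
    · congr 1
      rw [deletions, map_sum, map_sum]
      simp only [map_smul, prepend_single, strip_single_append]
    · intro i hi
      rw [Finset.mem_range] at hi
      rw [map_smul, ← List.eraseIdx_append_of_lt_length hi,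
        strip_single_eq_zero (not_prefix_eraseIdx hq ha hw (by omega)), smul_zero]
  · rw [strip_single_eq_zero h, map_zero, smul_zero, deletions, map_sum]
    refine Finset.sum_eq_zero fun i _ => ?_
    rw [map_smul, strip_single_eq_zero, smul_zero]
    rcases Nat.lt_or_ge p i with hi | hi
    · exact fun h' => h (prefix_of_prefix_eraseIdx hq hi h')
    · exact not_prefix_eraseIdx hq ha hw hi

lemma deletions_mem {S : Finset A} {r : ℕ} {w : List (A × Γ)} (hw : w ∈ injWords Γ S (r + 1)) :
    deletions w ∈ Finsupp.supported ℤ ℤ (injWords Γ S r) := by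
  refine Submodule.sum_mem _ fun i hi => Submodule.smul_mem _ _ ?_
  refine Finsupp.single_mem_supported ℤ _ ⟨?_, ?_, ?_⟩
  · rw [List.length_eraseIdx_of_lt (Finset.mem_range.1 hi), hw.1]; rfl
  · exact hw.2.1.sublist ((List.eraseIdx_sublist w i).map _)
  · exact fun x hx => hw.2.2 x ((List.eraseIdx_sublist w i).mem hx)

lemma del_mem {S : Finset A} {r : ℕ} {z : WordModule (A × Γ)}
    (hz : z ∈ Finsupp.supported ℤ ℤ (injWords Γ S (r + 1))) :
    del z ∈ Finsupp.supported ℤ ℤ (injWords Γ S r) :=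
  map_mem_of_supported (fun w hw => by rw [del_single]; exact deletions_mem hw) hz

/-- Letters occurring in a word, forgetting colours. -/
def lettersOf [DecidableEq A] (q : List (A × Γ)) : Finset A := (q.map Prod.fst).toFinset

lemma append_mem_injWords_iff [DecidableEq A] {S : Finset A} {r : ℕ} {q v : List (A × Γ)}
    {k : ℕ} (hk : q ∈ injWords Γ S k) :
    q ++ v ∈ injWords Γ S (k + r) ↔ v ∈ injWords Γ (S \ lettersOf q) r := by
  obtain ⟨h1, h2, h3⟩ := hk
  simp only [injWords, Set.mem_ofPred_eq, List.length_append, List.map_append,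
    List.nodup_append, Finset.mem_sdiff, lettersOf, List.mem_toFinset, h1, h2, true_and,
    List.mem_append]
  constructor
  · rintro ⟨a1, ⟨a2, a3⟩, a4⟩
    refine ⟨by omega, a2, fun x hx => ⟨a4 x (Or.inr hx), fun hq => ?_⟩⟩
    exact a3 _ hq _ (List.mem_map_of_mem hx) rfl
  · rintro ⟨a1, a2, a3⟩
    refine ⟨by omega, ⟨a2, ?_⟩, ?_⟩
    · rintro b hb c hc rfl
      obtain ⟨x, hx, rfl⟩ := List.mem_map.1 hc
      exact (a3 x hx).2 hb
    · rintro x (hx | hx)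
      · exact h3 x hx
      · exact (a3 x hx).1

lemma del_prepend_sub_mem {a : A} {p : ℕ} {q : List (A × Γ)} (hq : q.length = p + 1)
    {z : WordModule (A × Γ)} (hz : z ∈ Finsupp.supported ℤ ℤ (avoidFrom Γ a 0)) :
    (del (prepend q z) - (-1 : ℤ) ^ (p + 1) • prepend q (del z)) ∈
      Finsupp.supported ℤ ℤ (avoidFrom Γ a p) := by
  refine map_mem_of_supported (f := del ∘ₗ prepend q - (-1 : ℤ) ^ (p + 1) • (prepend q ∘ₗ del))
    (fun v hv => ?_) hz
  simp only [LinearMap.sub_apply, LinearMap.comp_apply, LinearMap.smul_apply, prepend_single,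
    del_single]
  rw [deletions_append, hq, add_sub_cancel_right]
  refine Submodule.sum_mem _ fun i hi => Submodule.smul_mem _ _ ?_
  refine Finsupp.single_mem_supported ℤ _ ?_
  have hl : (q.eraseIdx i).length = p := by
    rw [List.length_eraseIdx_of_lt (by rw [Finset.mem_range] at hi; omega), hq]; rfl
  change a ∉ (List.drop p _).map Prod.fst
  rw [List.drop_left' hl]
  exact hv

lemma exists_sub_del_mem_avoidFrom {S : Finset A} {a : A} {r p : ℕ}
    (hr : r < S.card)
    (ih : ∀ T ⊂ S, ∀ k < T.card, ∀ z ∈ Finsupp.supported ℤ ℤ (injWords Γ T k), del z = 0 →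
      ∃ y ∈ Finsupp.supported ℤ ℤ (injWords Γ T (k + 1)), del y = z)
    {z : WordModule (A × Γ)} (hz : z ∈ Finsupp.supported ℤ ℤ (injWords Γ S r))
    (hza : z ∈ Finsupp.supported ℤ ℤ (avoidFrom Γ a (p + 1))) (hd : del z = 0) :
    ∃ y ∈ Finsupp.supported ℤ ℤ (injWords Γ S (r + 1)),
      z - del y ∈ Finsupp.supported ℤ ℤ (avoidFrom Γ a p) := by
  classical
  let Q : Finset (List (A × Γ)) :=
    (z.support.filter fun w => a ∈ (w.drop p).map Prod.fst).image (List.take (p + 1))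
  have hQ : ∀ q ∈ Q, p + 1 ≤ r ∧ q ∈ injWords Γ S (p + 1) ∧ a ∈ (q.drop p).map Prod.fst := by
    intro q hq
    obtain ⟨w, hw, rfl⟩ := Finset.mem_image.1 hq
    rw [Finset.mem_filter] at hw
    obtain ⟨h1, h2, h3⟩ := hz hw.1
    have hpr : p + 1 ≤ r := by
      by_contra hlt
      rw [List.drop_eq_nil_of_le (by omega)] at hw
      simp at hw
    refine ⟨hpr, ⟨by simp; omega, h2.sublist ((List.take_sublist _ _).map _),
      fun x hx => h3 x ((List.take_sublist _ _).mem hx)⟩, ?_⟩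
    have h4 : a ∉ (w.drop (p + 1)).map Prod.fst := hza hw.1
    have h5 := hw.2
    rw [← List.take_append_drop (p + 1) w, List.drop_append_of_le_length (by simp; omega),
      List.map_append, List.mem_append] at h5
    exact h5.resolve_right h4
  have hY : ∀ q ∈ Q, ∃ y ∈ Finsupp.supported ℤ ℤ (injWords Γ (S \ lettersOf q) (r - p)),
      del y = strip q z := by
    intro q hq
    obtain ⟨hpr, hqS, haq⟩ := hQ q hq
    have hsub : lettersOf q ⊆ S := by
      intro b hb
      obtain ⟨x, hx, rfl⟩ := List.mem_map.1 (List.mem_toFinset.1 hb)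
      exact hqS.2.2 x hx
    have hcard : (lettersOf q).card = p + 1 := by
      rw [lettersOf, List.toFinset_card_of_nodup hqS.2.1, List.length_map, hqS.1]
    have e : r - p = (r - (p + 1)) + 1 := by omega
    rw [e]
    refine ih _ ?_ _ ?_ _ ?_ ?_
    · refine Finset.sdiff_ssubset hsub (Finset.card_pos.1 (by omega))
    · rw [Finset.card_sdiff_of_subset hsub]
      omega
    · intro v hv
      have hv' : q ++ v ∈ z.support := by
        rw [Finset.mem_coe, Finsupp.mem_support_iff, strip_apply] at hv
        exact Finsupp.mem_support_iff.2 hv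
      rw [← append_mem_injWords_iff hqS, Nat.add_sub_cancel' hpr]
      exact hz hv'
    · have h := strip_del hqS.1 haq hza
      rw [hd, map_zero] at h
      rcases neg_one_pow_eq_or ℤ (p + 1) with h1 | h1 <;> rw [h1] at h <;> simpa using h.symm
  choose! Y hYmem hYdel using hY
  refine ⟨∑ q ∈ Q, (-1 : ℤ) ^ (p + 1) • prepend q (Y q), ?_, ?_⟩
  · refine Submodule.sum_mem _ fun q hq => Submodule.smul_mem _ _ ?_
    obtain ⟨hpr, hqS, haq⟩ := hQ q hq
    refine map_mem_of_supported (fun v hv => ?_) (hYmem q hq)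
    rw [prepend_single]
    refine Finsupp.single_mem_supported ℤ _ ?_
    rw [← append_mem_injWords_iff hqS] at hv
    convert hv using 2
    omega
  · have key : z - ∑ q ∈ Q, prepend q (strip q z) ∈
        Finsupp.supported ℤ ℤ (avoidFrom Γ a p) := by
      intro w hw haw
      rw [Finset.mem_coe, Finsupp.mem_support_iff] at hw
      apply hw
      rw [Finsupp.sub_apply, Finsupp.finsetSum_apply]
      have h1 : ∀ q ∈ Q, prepend q (strip q z) w =
          if w.take (p + 1) = q then z w else 0 := by
        intro q hq
        rw [prepend_apply, (hQ q hq).2.1.1]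
        split_ifs with h
        · rw [strip_apply]
          conv_lhs => rw [← h, List.take_append_drop]
        · rfl
      rw [Finset.sum_congr rfl h1, Finset.sum_ite_eq]
      split_ifs with h
      · exact sub_self _
      · rw [sub_zero]
        by_contra hzw
        exact h (Finset.mem_image_of_mem _
          (Finset.mem_filter.2 ⟨Finsupp.mem_support_iff.2 hzw, haw⟩))
    have e : z - del (∑ q ∈ Q, (-1 : ℤ) ^ (p + 1) • prepend q (Y q)) =
        (z - ∑ q ∈ Q, prepend q (strip q z)) -
        ∑ q ∈ Q, (-1 : ℤ) ^ (p + 1) •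
          (del (prepend q (Y q)) - (-1 : ℤ) ^ (p + 1) • prepend q (del (Y q))) := by
      have h2 : ((-1 : ℤ) ^ (p + 1)) * (-1) ^ (p + 1) = 1 := by
        rw [← mul_pow]; simp
      simp only [smul_sub, smul_smul, h2, one_smul, Finset.sum_sub_distrib, map_sum, map_smul]
      rw [Finset.sum_congr rfl fun q hq => congrArg (prepend q) (hYdel q hq)]
      abel
    rw [e]
    refine Submodule.sub_mem _ key (Submodule.sum_mem _ fun q hq => Submodule.smul_mem _ _ ?_)
    obtain ⟨hpr, hqS, haq⟩ := hQ q hq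
    refine del_prepend_sub_mem hqS.1 fun v hv hav => ?_
    obtain ⟨x, hx, rfl⟩ := List.mem_map.1 hav
    have := (hYmem q hq hv).2.2 x hx
    rw [Finset.mem_sdiff] at this
    apply this.2
    rw [lettersOf, List.mem_toFinset]
    exact ((List.drop_sublist p q).map Prod.fst).mem haq

lemma exists_del_eq_of_mem_avoidFrom_zero {S : Finset A} {a : A} (ha : a ∈ S) (c : Γ) {r : ℕ}
    {z : WordModule (A × Γ)} (hz : z ∈ Finsupp.supported ℤ ℤ (injWords Γ S r))
    (hza : z ∈ Finsupp.supported ℤ ℤ (avoidFrom Γ a 0)) (hd : del z = 0) :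
    ∃ y ∈ Finsupp.supported ℤ ℤ (injWords Γ S (r + 1)), del y = z := by
  refine ⟨prepend [(a, c)] z, ?_, by rw [del_prepend_letter, hd, map_zero, sub_zero]⟩
  have hmem : z ∈ Finsupp.supported ℤ ℤ (injWords Γ S r ∩ avoidFrom Γ a 0) :=
    Set.subset_inter hz hza
  refine map_mem_of_supported (fun w hw => ?_) hmem
  rw [prepend_single]
  obtain ⟨⟨h1, h2, h3⟩, h4⟩ := hw
  refine Finsupp.single_mem_supported ℤ _ ⟨by simp [h1], ?_, ?_⟩
  · exact List.nodup_cons.2 ⟨h4, h2⟩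
  · intro x hx
    rcases List.mem_cons.1 hx with rfl | hx
    · exact ha
    · exact h3 x hx

/-- The complex of injective words is acyclic below the number of letters. -/
theorem exists_del_eq [Nonempty Γ] (S : Finset A) : ∀ r < S.card,
    ∀ z ∈ Finsupp.supported ℤ ℤ (injWords Γ S r), del z = 0 →
      ∃ y ∈ Finsupp.supported ℤ ℤ (injWords Γ S (r + 1)), del y = z := by
  induction S using Finset.strongInduction with
  | H S ih =>
    intro r hr z hz hd
    obtain ⟨a, ha⟩ := Finset.card_pos.1 (Nat.zero_lt_of_lt hr)
    obtain ⟨c⟩ := ‹Nonempty Γ›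
    have main : ∀ p, ∀ z ∈ Finsupp.supported ℤ ℤ (injWords Γ S r),
        z ∈ Finsupp.supported ℤ ℤ (avoidFrom Γ a p) → del z = 0 →
        ∃ y ∈ Finsupp.supported ℤ ℤ (injWords Γ S (r + 1)), del y = z := by
      intro p
      induction p with
      | zero => exact fun z hz hza hd => exists_del_eq_of_mem_avoidFrom_zero ha c hz hza hd
      | succ p ihp =>
        intro z hz hza hd
        obtain ⟨y, hy, hzy⟩ := exists_sub_del_mem_avoidFrom hr ih hz hza hd
        obtain ⟨y', hy', h⟩ := ihp (z - del y) (Submodule.sub_mem _ hz (del_mem hy)) hzy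
          (by rw [map_sub, hd, del_del, sub_zero])
        exact ⟨y' + y, Submodule.add_mem _ hy' hy, by rw [map_add, h, sub_add_cancel]⟩
    refine main r z hz (fun w hw haw => ?_) hd
    rw [List.drop_eq_nil_of_le (hz hw).1.le] at haw
    simp at haw

end WordModule

section Bridge

open WordModule

variable {A Γ : Type}

/-- The word underlying a generator. -/
def IWGen.toWord {r : ℕ} (g : IWGen A Γ r) : List (A × Γ) :=
  List.ofFn fun i => (g.letters i, g.colors i)

lemma IWGen.toWord_injective (r : ℕ) :
    Function.Injective (IWGen.toWord : IWGen A Γ r → List (A × Γ)) := by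
  rintro ⟨l, hl, c⟩ ⟨l', hl', c'⟩ h
  have h' := List.ofFn_injective h
  simp only [funext_iff, Prod.mk.injEq] at h'
  obtain rfl : l = l' := funext fun i => (h' i).1
  obtain rfl : c = c' := funext fun i => (h' i).2
  rfl

lemma List.ofFn_succAbove {X : Type} {r : ℕ} (f : Fin (r + 1) → X) (i : Fin (r + 1)) :
    List.ofFn (f ∘ i.succAbove) = (List.ofFn f).eraseIdx i := by
  refine List.ext_getElem ?_ fun k h1 h2 => ?_
  · rw [List.length_eraseIdx_of_lt (by simp [Fin.is_le])]; simp
  · rw [List.getElem_eraseIdx]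
    simp only [List.getElem_ofFn, Function.comp_apply]
    split_ifs with h
    · rw [Fin.succAbove_of_castSucc_lt _ _ h]
      rfl
    · rw [Fin.succAbove_of_le_castSucc _ _ (by simpa [Fin.le_def] using h)]
      rfl

lemma IWGen.toWord_face {r : ℕ} (i : Fin (r + 1)) (g : IWGen A Γ (r + 1)) :
    (IWface i g).toWord = g.toWord.eraseIdx i :=
  List.ofFn_succAbove (fun j => (g.letters j, g.colors j)) i

lemma IWGen.toWord_mem [Fintype A] {r : ℕ} (g : IWGen A Γ r) :
    g.toWord ∈ injWords Γ Finset.univ r := by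
  refine ⟨by simp [IWGen.toWord], ?_, fun _ _ => Finset.mem_univ _⟩
  rw [IWGen.toWord, List.map_ofFn, List.nodup_ofFn]
  exact g.inj

lemma IWGen.exists_toWord_eq [Fintype A] {r : ℕ} {w : List (A × Γ)}
    (hw : w ∈ injWords Γ Finset.univ r) : ∃ g : IWGen A Γ r, g.toWord = w := by
  obtain ⟨rfl, h2, -⟩ := hw
  refine ⟨⟨fun i => (w.get i).1, ?_, fun i => (w.get i).2⟩, List.ofFn_get w⟩
  rw [← List.ofFn_get w, List.map_ofFn, List.nodup_ofFn] at h2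
  exact h2

/-- The embedding of `C_r(A)` into the free abelian group on all words. -/
noncomputable def chainsToWords (A Γ : Type) (r : ℕ) :
    IWChains A Γ r →ₗ[ℤ] WordModule (A × Γ) :=
  Finsupp.lmapDomain ℤ ℤ IWGen.toWord

lemma chainsToWords_injective (r : ℕ) : Function.Injective (chainsToWords A Γ r) :=
  Finsupp.mapDomain_injective (IWGen.toWord_injective r)

lemma chainsToWords_single {r : ℕ} (g : IWGen A Γ r) :
    chainsToWords A Γ r (Finsupp.single g 1) = Finsupp.single g.toWord 1 := by
  simp [chainsToWords]

lemma range_chainsToWords [Fintype A] (r : ℕ) :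
    LinearMap.range (chainsToWords A Γ r) =
      Finsupp.supported ℤ ℤ (injWords Γ Finset.univ r) := by
  have h : injWords Γ Finset.univ r = IWGen.toWord '' (Set.univ : Set (IWGen A Γ r)) := by
    ext w
    simp only [Set.image_univ, Set.mem_range]
    exact ⟨IWGen.exists_toWord_eq, by rintro ⟨g, rfl⟩; exact g.toWord_mem⟩
  rw [h, ← Finsupp.lmapDomain_supported, Finsupp.supported_univ, LinearMap.range_eq_map]
  rfl

lemma chainsToWords_IWd (r : ℕ) (z : IWChains A Γ (r + 1)) :
    chainsToWords A Γ r (IWd A Γ r z) = del (chainsToWords A Γ (r + 1) z) := by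
  have h : chainsToWords A Γ r ∘ₗ (IWd A Γ r).toIntLinearMap =
      del ∘ₗ chainsToWords A Γ (r + 1) := by
    refine Finsupp.lhom_ext' fun g => LinearMap.ext_ring ?_
    simp only [LinearMap.comp_apply, Finsupp.lsingle_apply, chainsToWords_single, del_single,
      AddMonoidHom.coe_toIntLinearMap]
    have hl : g.toWord.length = r + 1 := by simp [IWGen.toWord]
    rw [deletions, hl, Finset.sum_range]
    simp only [IWd, Finsupp.liftAddHom_apply_single, zmultiplesHom_apply, one_smul, map_sum,
      map_smul, chainsToWords_single, IWGen.toWord_face]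
  exact LinearMap.congr_fun h z

lemma del_chainsToWords_of_mem_cycles {r : ℕ} {z : IWChains A Γ r}
    (hz : z ∈ IWcycles A Γ r) : del (chainsToWords A Γ r z) = 0 := by
  cases r with
  | succ r =>
    have h : IWd A Γ r z = 0 := hz
    rw [← chainsToWords_IWd, h, map_zero]
  | zero =>
    have h : del ∘ₗ chainsToWords A Γ 0 = 0 := by
      refine Finsupp.lhom_ext' fun g => LinearMap.ext_ring ?_
      simp [chainsToWords_single, deletions, IWGen.toWord]
    exact LinearMap.congr_fun h z

lemma IWboundaries_le_cycles (r : ℕ) : IWboundaries A Γ r ≤ IWcycles A Γ r := by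
  rintro _ ⟨y, rfl⟩
  cases r with
  | zero => exact AddSubgroup.mem_top _
  | succ r =>
    refine AddMonoidHom.mem_ker.2 (chainsToWords_injective r ?_)
    rw [chainsToWords_IWd, chainsToWords_IWd, del_del, map_zero]

/-- The complex `C_*(A)` is exact in degrees below `|A|`. -/
theorem IWboundaries_eq_cycles [Fintype A] [Nonempty Γ] {r : ℕ} (hr : r < Fintype.card A) :
    IWboundaries A Γ r = IWcycles A Γ r := by
  refine le_antisymm (IWboundaries_le_cycles r) fun z hz => ?_
  obtain ⟨y, hy, h⟩ := exists_del_eq Finset.univ r hr (chainsToWords A Γ r z)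
    (range_chainsToWords (A := A) (Γ := Γ) r ▸ LinearMap.mem_range_self _ z)
    (del_chainsToWords_of_mem_cycles hz)
  rw [← range_chainsToWords] at hy
  obtain ⟨x, rfl⟩ := hy
  exact ⟨x, chainsToWords_injective r (by rw [chainsToWords_IWd, h])⟩

/-- A generator is an injection of positions into letters together with a colouring. -/
def IWGen.equiv (A Γ : Type) (r : ℕ) : IWGen A Γ r ≃ (Fin r ↪ A) × (Fin r → Γ) where
  toFun g := (⟨g.letters, g.inj⟩, g.colors)
  invFun p := ⟨p.1, p.1.injective, p.2⟩
  left_inv _ := rfl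
  right_inv _ := rfl

instance [Finite A] [Finite Γ] (r : ℕ) : Finite (IWGen A Γ r) :=
  Finite.of_equiv _ (IWGen.equiv A Γ r).symm

lemma finrank_IWChains [Fintype A] [Fintype Γ] (r : ℕ) :
    Module.finrank ℤ (IWChains A Γ r) =
      (Fintype.card A).descFactorial r * Fintype.card Γ ^ r := by
  classical
  have := Fintype.ofFinite (IWGen A Γ r)
  rw [Module.finrank_finsupp_self, Fintype.card_congr (IWGen.equiv A Γ r), Fintype.card_prod,
    Fintype.card_embedding_eq, Fintype.card_fun, Fintype.card_fin]

lemma finrank_cycles_succ_add [Fintype A] [Fintype Γ] [Nonempty Γ] {r : ℕ}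
    (hr : r < Fintype.card A) :
    Module.finrank ℤ (IWcycles A Γ (r + 1)) + Module.finrank ℤ (IWcycles A Γ r) =
      (Fintype.card A).descFactorial (r + 1) * Fintype.card Γ ^ (r + 1) := by
  let f := (IWd A Γ r).toIntLinearMap
  rw [← finrank_IWChains, ← Submodule.finrank_quotient_add_finrank (LinearMap.ker f),
    f.quotKerEquivRange.finrank_eq, add_comm, ← IWboundaries_eq_cycles hr]
  rfl

lemma finrank_cycles_zero (A Γ : Type) [Fintype A] [Fintype Γ] :
    Module.finrank ℤ (IWcycles A Γ 0) = 1 := by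
  have h := finrank_IWChains (A := A) (Γ := Γ) 0
  rw [Nat.descFactorial_zero, pow_zero, mul_one, ← finrank_top ℤ (IWChains A Γ 0)] at h
  exact h

lemma finrank_cycles [Fintype A] [Fintype Γ] [Nonempty Γ] {r : ℕ}
    (hr : r ≤ Fintype.card A) :
    (Module.finrank ℤ (IWcycles A Γ r) : ℤ) = ∑ i ∈ Finset.range (r + 1),
      (-1 : ℤ) ^ (r - i) * ((Fintype.card A).descFactorial i : ℤ) *
        (Fintype.card Γ : ℤ) ^ i := by
  induction r with
  | zero => simp [finrank_cycles_zero]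
  | succ r ih =>
    have h := finrank_cycles_succ_add (Γ := Γ) (Nat.lt_of_succ_le hr)
    zify at h
    rw [eq_sub_of_add_eq h, ih (by omega), Finset.sum_range_succ _ (r + 1), sub_eq_add_neg,
      add_comm, ← Finset.sum_neg_distrib]
    congr 1
    · refine Finset.sum_congr rfl fun i hi => ?_
      rw [Finset.mem_range] at hi
      rw [show r + 1 - i = (r - i) + 1 by omega, pow_succ]
      ring
    · simp

lemma dln_eq_sum_descFactorial (ℓ n : ℕ) :
    dln ℓ n = ∑ i ∈ Finset.range (n + 1),
      (-1 : ℤ) ^ (n - i) * (n.descFactorial i : ℤ) * (ℓ : ℤ) ^ i := by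
  rw [dln, ← Finset.sum_range_reflect]
  refine Finset.sum_congr rfl fun i hi => ?_
  have hi' : i ≤ n := by rw [Finset.mem_range] at hi; omega
  rw [Nat.descFactorial_eq_div hi', show n + 1 - 1 - i = n - i by omega, Nat.sub_sub_self hi']

/-- In top degree there are no boundaries, so homology is the group of cycles. -/
noncomputable def topHomologyEquiv [Fintype A] {n : ℕ} (hn : Fintype.card A = n) :
    IWcycles A Γ n ≃+ IWhomology A Γ n :=
  have h : (IWboundaries A Γ n).addSubgroupOf (IWcycles A Γ n) = ⊥ := by
    have : IsEmpty (IWGen A Γ (n + 1)) := by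
      refine ⟨fun g => ?_⟩
      have := Fintype.card_le_of_injective _ g.inj
      rw [Fintype.card_fin] at this
      omega
    have hb : IWboundaries A Γ n = ⊥ := by
      rw [eq_bot_iff]
      rintro _ ⟨y, rfl⟩
      rw [Subsingleton.elim y 0, map_zero]
      exact AddSubgroup.zero_mem _
    rw [hb, AddSubgroup.bot_addSubgroupOf]
  (QuotientAddGroup.quotientBot.symm.trans (QuotientAddGroup.quotientAddEquivOfEq h.symm) :
    IWcycles A Γ n ≃+ IWcycles A Γ n ⧸ (IWboundaries A Γ n).addSubgroupOf (IWcycles A Γ n))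

end Bridge

/-- **Theorem**: if `|A| = n ≥ 1` and `Γ` is a finite nonempty set with
`|Γ| = ℓ`, then the top homology group `H_n(C_*(A))` is a free abelian group of
rank `d(ℓ)_n = Σ_{i=0}^n (-1)^i (n!/i!) ℓ^(n-i)`. -/
theorem top_homology_free_of_rank_dln
    (A Γ : Type) [Fintype A] [Fintype Γ] [Nonempty Γ]
    (n : ℕ) (hn : Fintype.card A = n) (h1 : 1 ≤ n)
    (ℓ : ℕ) (hΓ : Fintype.card Γ = ℓ) :
    Module.Free ℤ (IWhomology A Γ n) ∧ Module.Finite ℤ (IWhomology A Γ n) ∧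
      (Module.finrank ℤ (IWhomology A Γ n) : ℤ) = dln ℓ n := by

  have e : IWcycles A Γ n ≃ₗ[ℤ] IWhomology A Γ n := (topHomologyEquiv hn).toIntLinearEquiv
  have hfin : Module.Finite ℤ (IWcycles A Γ n) :=
    inferInstanceAs (Module.Finite ℤ (AddSubgroup.toIntSubmodule (IWcycles A Γ n)))
  have hfree : Module.Free ℤ (IWcycles A Γ n) :=
    inferInstanceAs (Module.Free ℤ (AddSubgroup.toIntSubmodule (IWcycles A Γ n)))
  refine ⟨Module.Free.of_equiv e, Module.Finite.equiv e, ?_⟩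
  rw [← e.finrank_eq, finrank_cycles hn.ge, dln_eq_sum_descFactorial, hn, hΓ]
end

section
/- Let G be a finite group of order ℓ and let n ≥ 1. Consider the action of the wreath product G ≀ S_n = S_n ⋉ G^n on the set {1, ..., n} × G given by (π; g_1, ..., g_n) · (a, γ) := (π(a), g_a γ). Then the number of elements of G ≀ S_n having no fixed point in {1, ..., n} × G equals d(ℓ)_n := Σ_{i=0}^n (−1)^i (n!/i!) ℓ^{n−i}. -/
/-- The action of `S_n` on `G^n` by permuting the coordinates, as a
homomorphism `S_n →* MulAut (G^n)`: `(π · g) i = g (π⁻¹ i)`. -/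
def permMulAut (G : Type) [Group G] (n : ℕ) :
    Equiv.Perm (Fin n) →* MulAut (Fin n → G) where
  toFun π := MulEquiv.arrowCongr π (MulEquiv.refl G)
  map_one' := by ext x i; rfl
  map_mul' π σ := by ext x i; rfl

/-- The wreath product `G ≀ S_n := S_n ⋉ G^n`. -/
def WreathProduct (G : Type) [Group G] (n : ℕ) : Type :=
  SemidirectProduct (Fin n → G) (Equiv.Perm (Fin n)) (permMulAut G n)

noncomputable instance (G : Type) [Group G] (n : ℕ) : Group (WreathProduct G n) :=
  inferInstanceAs (Group (SemidirectProduct _ _ _))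

/-- The action of `G ≀ S_n` on `{1, …, n} × G`:
`(π; g_1, …, g_n) · (a, γ) = (π(a), g_a γ)`. -/
def wreathSmul {G : Type} [Group G] {n : ℕ} (w : WreathProduct G n)
    (p : Fin n × G) : Fin n × G :=
  (SemidirectProduct.rightHom (φ := permMulAut G n) w p.1,
    (w : SemidirectProduct (Fin n → G) (Equiv.Perm (Fin n)) (permMulAut G n)).left p.1 * p.2)

open Finset in
/-- The number of permutations of a finite type fixing every element of `t`. -/
theorem card_perm_fixing_finset {α : Type*} [Fintype α] [DecidableEq α] (t : Finset α) :
    #{π : Equiv.Perm α | ∀ a ∈ t, π a = a} = (Fintype.card α - #t).factorial := by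
  have h := Fintype.card_congr (Equiv.Perm.subtypeEquivSubtypePerm (fun a : α => a ∉ t))
  rw [Fintype.card_perm, Fintype.card_subtype_compl, Fintype.card_coe] at h
  rw [h, Fintype.card_subtype]
  simp only [not_not]

open Finset in
/-- The number of functions between finite types taking the value `c` on all of `t`. -/
theorem card_fun_eq_on_finset {α β : Type*} [Fintype α] [DecidableEq α] [Fintype β]
    [DecidableEq β] (c : β) (t : Finset α) :
    #{g : α → β | ∀ a ∈ t, g a = c} = Fintype.card β ^ (Fintype.card α - #t) := by
  have h : ({g : α → β | ∀ a ∈ t, g a = c} : Finset (α → β)) =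
      Fintype.piFinset fun a => if a ∈ t then {c} else univ := by
    ext g
    simp only [mem_filter, mem_univ, true_and, Fintype.mem_piFinset]
    refine forall_congr' fun a => ?_
    split_ifs with ha <;> simp [ha]
  rw [h, Fintype.card_piFinset]
  simp only [apply_ite Finset.card, card_singleton, card_univ]
  rw [prod_ite, prod_const_one, one_mul, prod_const, ← card_compl]
  congr 2
  ext a
  simp

open Finset in
/-- The number of pairs of a function and a permutation such that no fixed point of the permutation
is sent to `c` by the function. -/
theorem card_fun_perm_fixed_ne {α β : Type*} [Fintype α] [DecidableEq α] [Fintype β]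
    [DecidableEq β] (c : β) :
    (#{x : (α → β) × Equiv.Perm α | ∀ a, ¬(x.2 a = a ∧ x.1 a = c)} : ℤ) =
      dln (Fintype.card β) (Fintype.card α) := by
  set S : α → Finset ((α → β) × Equiv.Perm α) := fun a => {x | x.2 a = a ∧ x.1 a = c} with hS
  have hcompl : ({x : (α → β) × Equiv.Perm α | ∀ a, ¬(x.2 a = a ∧ x.1 a = c)} : Finset _) =
      univ.inf fun a => (S a)ᶜ := by
    ext x
    simp [hS, mem_inf]
  have hinf (t : Finset α) : #(t.inf S) =
      (Fintype.card α - #t).factorial * Fintype.card β ^ (Fintype.card α - #t) := by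
    have h : t.inf S = ({g : α → β | ∀ a ∈ t, g a = c} : Finset _) ×ˢ
        ({π : Equiv.Perm α | ∀ a ∈ t, π a = a} : Finset _) := by
      ext x
      simp only [hS, mem_inf, mem_filter, mem_univ, true_and, mem_product]
      exact ⟨fun h => ⟨fun a ha => (h a ha).2, fun a ha => (h a ha).1⟩,
        fun h a ha => ⟨h.2 a ha, h.1 a ha⟩⟩
    rw [h, card_product, card_fun_eq_on_finset, card_perm_fixing_finset, mul_comm]
  rw [hcompl, inclusion_exclusion_card_inf_compl]
  simp only [hinf]
  rw [sum_powerset_apply_card (fun k => (-1 : ℤ) ^ k *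
    (((Fintype.card α - k).factorial * Fintype.card β ^ (Fintype.card α - k) : ℕ) : ℤ)), dln,
    card_univ]
  refine sum_congr rfl fun i hi => ?_
  have hle : i ≤ Fintype.card α := Nat.lt_succ_iff.mp (mem_range.mp hi)
  have hdiv : (Fintype.card α).factorial / i.factorial =
      (Fintype.card α).choose i * (Fintype.card α - i).factorial := by
    rw [← Nat.choose_mul_factorial_mul_factorial hle, mul_right_comm,
      Nat.mul_div_cancel _ (Nat.factorial_pos i)]
  rw [hdiv, nsmul_eq_mul]
  push_cast
  ring

/-- An element of the wreath product is fixed-point free iff its component at every fixed point of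
the underlying permutation is nontrivial. -/
theorem forall_wreathSmul_ne_iff {G : Type} [Group G] {n : ℕ}
    (w : SemidirectProduct (Fin n → G) (Equiv.Perm (Fin n)) (permMulAut G n)) :
    (∀ p : Fin n × G, wreathSmul (w : WreathProduct G n) p ≠ p) ↔
      ∀ a, ¬(w.right a = a ∧ w.left a = 1) := by
  simp [wreathSmul, Prod.ext_iff]

/-- For a finite group `G` of order `ℓ` and `n ≥ 1`, the number of elements of
the wreath product `G ≀ S_n` having no fixed point in `{1, …, n} × G` (for the
action `(π; g_1, …, g_n) · (a, γ) = (π(a), g_a γ)`) equals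
`d(ℓ)_n = Σ_{i=0}^n (-1)^i (n!/i!) ℓ^(n-i)`. -/
theorem card_fixed_point_free_elements_of_wreath_product
    (G : Type) [Group G] [Fintype G] (ℓ : ℕ) (hG : Fintype.card G = ℓ)
    (n : ℕ) (hn : 1 ≤ n) :
    (Nat.card {w : WreathProduct G n // ∀ p : Fin n × G, wreathSmul w p ≠ p} : ℤ) =
      dln ℓ n := by
  classical
  subst hG
  have e : {w : WreathProduct G n // ∀ p : Fin n × G, wreathSmul w p ≠ p} ≃
      {x : (Fin n → G) × Equiv.Perm (Fin n) // ∀ a, ¬(x.2 a = a ∧ x.1 a = 1)} :=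
    SemidirectProduct.equivProd.subtypeEquiv forall_wreathSmul_ne_iff
  have h := card_fun_perm_fixed_ne (α := Fin n) (1 : G)
  rw [Fintype.card_fin] at h
  rw [Nat.card_congr e, Nat.card_eq_fintype_card, Fintype.card_subtype, ← h]
  congr!
end
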